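/- There is a universal constant C > 0 with the following property. For every n ≥ 1, every h > 1, every ε ∈ (0,1), and every γ ∈ (0,1), there exists a function A mapping every sequence of m value profiles in [1,h]ⁿ to a measurable DSIC and IR mechanism such that: for every product Borel probability distribution D on [1,h]ⁿ, if m ≥ C·h·ε^{−2}·(n·ε^{−1}·(log h)·log(n·(log h)/ε) + log(1/γ)), then with probability at least 1−γ over m i.i.d. samples v₁,…,v_m from D, Rev(A(v₁,…,v_m), D) ≥ (1 − C·ε)·Opt(D). -/

import Mathlib

open MeasureTheory

/-- A (direct-revelation) mechanism for `n` buyers and one item: an allocation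
rule and a payment rule on value profiles. -/
structure Mech (n : ℕ) where
  alloc : (Fin n → ℝ) → Fin n → ℝ
  pay : (Fin n → ℝ) → Fin n → ℝ

/-- Allocation probabilities are in `[0,1]` and sum to at most `1`. -/
def Mech.Valid {n : ℕ} (M : Mech n) : Prop :=
  ∀ v : Fin n → ℝ, (∀ i, 0 ≤ M.alloc v i ∧ M.alloc v i ≤ 1) ∧ ∑ i, M.alloc v i ≤ 1

/-- Dominant strategy incentive compatibility (on nonnegative value profiles). -/
def Mech.DSIC {n : ℕ} (M : Mech n) : Prop :=
  ∀ (i : Fin n) (v : Fin n → ℝ), (∀ j, 0 ≤ v j) → ∀ v' : ℝ, 0 ≤ v' →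
    v i * M.alloc (Function.update v i v') i - M.pay (Function.update v i v') i ≤
      v i * M.alloc v i - M.pay v i

/-- Individual rationality (on nonnegative value profiles). -/
def Mech.IR {n : ℕ} (M : Mech n) : Prop :=
  ∀ v : Fin n → ℝ, (∀ j, 0 ≤ v j) → ∀ i, 0 ≤ v i * M.alloc v i - M.pay v i

/-- Measurability of the allocation and payment rules. -/
def Mech.Meas {n : ℕ} (M : Mech n) : Prop :=
  (∀ i, Measurable fun v => M.alloc v i) ∧ (∀ i, Measurable fun v => M.pay v i)

/-- A measurable DSIC and IR mechanism. -/
def Mech.Good {n : ℕ} (M : Mech n) : Prop := M.Valid ∧ M.DSIC ∧ M.IR ∧ M.Meas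

/-- Expected revenue of mechanism `M` on value distribution `D`. -/
noncomputable def Rev {n : ℕ} (M : Mech n) (D : Measure (Fin n → ℝ)) : ℝ :=
  ∫ v, ∑ i, M.pay v i ∂D

/-- Optimal revenue: supremum of revenue over measurable DSIC and IR mechanisms. -/
noncomputable def Opt {n : ℕ} (D : Measure (Fin n → ℝ)) : ℝ :=
  sSup {r : ℝ | ∃ M : Mech n, M.Good ∧ r = Rev M D}


/-! ### Ironing -/

/-- Discrete revenue functional. -/
noncomputable def revFun (k : ℕ) (f g : ℕ → ℝ) (X : ℕ → ℝ) : ℝ :=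
  ∑ j ∈ Finset.range (k+1), f j * (g j * X j - ∑ l ∈ Finset.range j, (g (l+1) - g l) * X l)

lemma revFun_add (k : ℕ) (f g X Y : ℕ → ℝ) (s : ℝ) :
    revFun k f g (fun j => X j + s * Y j) = revFun k f g X + s * revFun k f g Y := by
  unfold revFun
  rw [Finset.mul_sum, ← Finset.sum_add_distrib]
  refine Finset.sum_congr rfl fun j _ => ?_
  have : ∑ l ∈ Finset.range j, (g (l+1) - g l) * (X l + s * Y l)
      = ∑ l ∈ Finset.range j, (g (l+1) - g l) * X l
        + s * ∑ l ∈ Finset.range j, (g (l+1) - g l) * Y l := by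
    rw [Finset.mul_sum, ← Finset.sum_add_distrib]
    exact Finset.sum_congr rfl fun l _ => by ring
  rw [this]; ring

/-- The ironing objective. -/
noncomputable def ironObj (k : ℕ) (f g : ℕ → ℝ) (y : ℕ → ℝ) : ℝ :=
  ∑ j ∈ Finset.range (k+1), f j * y j ^ 2 - 2 * revFun k f g y

lemma ironObj_add (k : ℕ) (f g y d : ℕ → ℝ) (s : ℝ) :
    ironObj k f g (fun j => y j + s * d j) = ironObj k f g y
      + 2 * s * (∑ j ∈ Finset.range (k+1), f j * d j * y j - revFun k f g d)
      + s ^ 2 * ∑ j ∈ Finset.range (k+1), f j * d j ^ 2 := by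
  unfold ironObj
  rw [revFun_add]
  have : ∑ j ∈ Finset.range (k+1), f j * (y j + s * d j) ^ 2
      = ∑ j ∈ Finset.range (k+1), f j * y j ^ 2
        + 2 * s * ∑ j ∈ Finset.range (k+1), f j * d j * y j
        + s ^ 2 * ∑ j ∈ Finset.range (k+1), f j * d j ^ 2 := by
    rw [Finset.mul_sum, Finset.mul_sum, ← Finset.sum_add_distrib, ← Finset.sum_add_distrib]
    exact Finset.sum_congr rfl fun l _ => by ring
  rw [this]; ring

lemma first_order {a b s0 : ℝ} (hs0 : 0 < s0)
    (h : ∀ s, 0 < s → s ≤ s0 → 0 ≤ 2 * s * a + s ^ 2 * b) : 0 ≤ a := by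
  by_contra ha
  push Not at ha
  have hb : 0 < |b| + 1 := by positivity
  have hs : 0 < min s0 (-a / (|b| + 1)) := lt_min hs0 (div_pos (by linarith) hb)
  have h1 := h _ hs (min_le_left _ _)
  set s := min s0 (-a / (|b| + 1))
  have h2 : s * (|b| + 1) ≤ -a := by
    rw [← le_div_iff₀ hb]; exact min_le_right _ _
  have h3 : b ≤ |b| := le_abs_self b
  nlinarith [mul_le_mul_of_nonneg_left h3 hs.le]

lemma ironing (k : ℕ) (f g : ℕ → ℝ) (hf : ∀ j, 0 ≤ f j) (hg : Monotone g) (hg0 : 0 ≤ g 0) :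
    ∃ y : ℕ → ℝ, Monotone y ∧ (∀ j, 0 ≤ y j) ∧
      (∀ X : ℕ → ℝ, Monotone X → (∀ j, 0 ≤ X j) →
        revFun k f g X ≤ ∑ j ∈ Finset.range (k+1), f j * X j * y j) ∧
      (∀ t : ℕ, 0 < y t → (∀ l < t, y l < y t) →
        ∑ j ∈ Finset.range (k+1), f j * (if t ≤ j then 1 else 0) * y j
          ≤ revFun k f g (fun j => if t ≤ j then 1 else 0)) := by
  set B := g k with hB
  have hB0 : 0 ≤ B := hg0.trans (hg (Nat.zero_le k))
  let S : Set (ℕ → ℝ) := (Set.univ.pi fun _ => Set.Icc 0 B) ∩ {y | Monotone y}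
  have hcl : IsClosed {y : ℕ → ℝ | Monotone y} := by
    have : {y : ℕ → ℝ | Monotone y} = ⋂ i : ℕ, {y : ℕ → ℝ | y i ≤ y (i+1)} := by
      ext y; simp only [Set.mem_ofPred_eq, Set.mem_iInter]
      exact ⟨fun h i => h (Nat.le_succ i), monotone_nat_of_le_succ⟩
    rw [this]
    exact isClosed_iInter fun i => isClosed_le (continuous_apply _) (continuous_apply _)
  have hS : IsCompact S := (isCompact_univ_pi fun _ => isCompact_Icc).inter_right hcl
  have hcont : Continuous (ironObj k f g) := by
    unfold ironObj revFun
    fun_prop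
  obtain ⟨y, ⟨hyB, hym⟩, hmin⟩ := hS.exists_isMinOn
    ⟨fun _ => 0, ⟨fun _ _ => ⟨le_rfl, hB0⟩, fun _ _ _ => le_rfl⟩⟩ hcont.continuousOn
  have hy0 : ∀ j, 0 ≤ y j := fun j => (hyB j trivial).1
  have hminAll : ∀ z : ℕ → ℝ, Monotone z → (∀ j, 0 ≤ z j) → ironObj k f g y ≤ ironObj k f g z := by
    intro z hz hz0
    have h1 : ironObj k f g y ≤ ironObj k f g (fun j => min (z j) B) := by
      apply hmin
      refine ⟨fun j _ => ⟨le_min (hz0 j) hB0, min_le_right _ _⟩, fun a b hab => ?_⟩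
      exact min_le_min (hz hab) le_rfl
    refine h1.trans ?_
    unfold ironObj revFun
    rw [Finset.mul_sum, Finset.mul_sum, ← Finset.sum_sub_distrib, ← Finset.sum_sub_distrib]
    refine Finset.sum_le_sum fun j hj => ?_
    have hjk : g j ≤ B := hg (by simpa [Nat.lt_succ_iff] using hj)
    have h2 : ∑ l ∈ Finset.range j, (g (l+1) - g l) * min (z l) B
        ≤ ∑ l ∈ Finset.range j, (g (l+1) - g l) * z l :=
      Finset.sum_le_sum fun l _ => mul_le_mul_of_nonneg_left (min_le_left _ _)
        (sub_nonneg.2 (hg (Nat.le_succ l)))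
    have h3 : min (z j) B ^ 2 - 2 * (g j * min (z j) B) ≤ z j ^ 2 - 2 * (g j * z j) := by
      rcases le_total (z j) B with h | h
      · rw [min_eq_left h]
      · rw [min_eq_right h]; nlinarith
    nlinarith [mul_le_mul_of_nonneg_left h2 (hf j), mul_le_mul_of_nonneg_left h3 (hf j)]
  refine ⟨y, hym, hy0, ?_, ?_⟩
  · intro X hX hX0
    have := first_order (a := ∑ j ∈ Finset.range (k+1), f j * X j * y j - revFun k f g X)
      (b := ∑ j ∈ Finset.range (k+1), f j * X j ^ 2) one_pos (fun s hs _ => by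
        have h1 := hminAll (fun j => y j + s * X j)
          (fun a b hab => add_le_add (hym hab) (mul_le_mul_of_nonneg_left (hX hab) hs.le))
          (fun j => add_nonneg (hy0 j) (mul_nonneg hs.le (hX0 j)))
        rw [ironObj_add] at h1
        linarith)
    linarith
  · intro t ht hlt
    obtain ⟨s0, hs0, hs0t, hs0l⟩ : ∃ s0, 0 < s0 ∧ s0 ≤ y t ∧ ∀ l < t, y l ≤ y t - s0 := by
      rcases t with _ | t
      · exact ⟨y 0, ht, le_rfl, fun l hl => absurd hl (Nat.not_lt_zero _)⟩
      · refine ⟨y (t+1) - y t, sub_pos.2 (hlt t (Nat.lt_succ_self t)), by linarith [hy0 t],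
          fun l hl => ?_⟩
        have := hym (Nat.lt_succ_iff.1 hl)
        linarith
    set X : ℕ → ℝ := fun j => if t ≤ j then 1 else 0 with hX
    have := first_order (a := -(∑ j ∈ Finset.range (k+1), f j * X j * y j - revFun k f g X))
      (b := ∑ j ∈ Finset.range (k+1), f j * X j ^ 2) hs0 (fun s hs hss => by
        have h1 := hminAll (fun j => y j + (-s) * X j)
          (by
            intro a b hab
            simp only [hX]
            have := hym hab
            by_cases hta : t ≤ a
            · simp [hta, hta.trans hab, this]
            · by_cases htb : t ≤ b
              · simp only [hta, htb, if_true, if_false]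
                have := hs0l a (not_le.1 hta)
                have := hym htb
                linarith
              · simp [hta, htb, this])
          (by
            intro j
            simp only [hX]
            split_ifs with h
            · have := hym h
              linarith
            · simpa using hy0 j)
        rw [ironObj_add] at h1
        linarith)
    linarith

/-! ### Level sums -/

lemma threshold_telescope (g : ℕ → ℝ) (t j : ℕ) :
    g j * (if t ≤ j then 1 else 0) - ∑ l ∈ Finset.range j, (g (l+1) - g l) * (if t ≤ l then 1 else 0)
      = (if t ≤ j then 1 else 0) * g t := by
  induction j with
  | zero =>
    by_cases h : t = 0
    · simp [h]
    · simp [h]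
  | succ j ih =>
    rw [Finset.sum_range_succ]
    by_cases h : t ≤ j
    · simp only [h, h.trans (Nat.le_succ j), if_true] at ih ⊢
      linarith
    · by_cases h' : t = j + 1
      · subst h'
        simp only [h, le_refl, if_true, if_false] at ih ⊢
        linarith
      · have h'' : ¬ t ≤ j + 1 := by omega
        simp only [h, h'', if_false] at ih ⊢
        linarith

lemma integral_levels (μ : Measure ℝ) [IsFiniteMeasure μ] (k : ℕ) (lev : ℝ → ℕ)
    (hlev : Measurable lev) (hk : ∀ w, lev w ≤ k) (φ : ℕ → ℝ) (x : ℝ → ℝ) (hx : Integrable x μ) :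
    ∫ w, φ (lev w) * x w ∂μ
      = ∑ j ∈ Finset.range (k+1), φ j * ∫ w in {w | lev w = j}, x w ∂μ := by
  have hm : ∀ j, MeasurableSet {w | lev w = j} := fun j => hlev (measurableSet_singleton j)
  have h1 : ∀ w, φ (lev w) * x w
      = ∑ j ∈ Finset.range (k+1), φ j * Set.indicator {w | lev w = j} x w := by
    intro w
    rw [Finset.sum_eq_single (lev w)]
    · simp
    · intro j _ hj
      simp [Ne.symm hj]
    · intro h
      exact absurd (Finset.mem_range.2 (Nat.lt_succ_of_le (hk w))) h
  simp_rw [h1]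
  rw [integral_finsetSum _ fun j _ => (hx.indicator (hm j)).const_mul _]
  refine Finset.sum_congr rfl fun j _ => ?_
  rw [integral_const_mul, integral_indicator (hm j)]

lemma integral_levels_one (μ : Measure ℝ) [IsFiniteMeasure μ] (k : ℕ) (lev : ℝ → ℕ)
    (hlev : Measurable lev) (hk : ∀ w, lev w ≤ k) (φ : ℕ → ℝ) :
    ∫ w, φ (lev w) ∂μ = ∑ j ∈ Finset.range (k+1), μ.real {w | lev w = j} * φ j := by
  have := integral_levels μ k lev hlev hk φ (fun _ => 1) (integrable_const 1)
  simp only [mul_one] at this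
  rw [this]
  refine Finset.sum_congr rfl fun j _ => ?_
  simp [mul_comm]

/-! ### Resampling one coordinate of a product measure -/

lemma pi_update_preserving {n : ℕ} (D : Fin n → Measure ℝ) (hD : ∀ i, IsProbabilityMeasure (D i))
    (i : Fin n) :
    Measure.map (fun q : (Fin n → ℝ) × ℝ => Function.update q.1 i q.2) ((Measure.pi D).prod (D i))
      = Measure.pi D := by
  have hmeas : Measurable (fun q : (Fin n → ℝ) × ℝ => Function.update q.1 i q.2) := by
    rw [measurable_pi_iff]
    intro j
    by_cases h : j = i
    · subst h; simpa using measurable_snd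
    · simp only [Function.update_of_ne h]
      exact (measurable_pi_apply j).comp measurable_fst
  symm
  apply Measure.pi_eq
  intro s hs
  rw [Measure.map_apply hmeas (MeasurableSet.univ_pi hs)]
  have : (fun q : (Fin n → ℝ) × ℝ => Function.update q.1 i q.2) ⁻¹' (Set.univ.pi s)
      = (Set.univ.pi (Function.update s i Set.univ)) ×ˢ (s i) := by
    ext q
    simp only [Set.mem_preimage, Set.mem_pi, Set.mem_univ, true_implies, Set.mem_prod]
    constructor
    · intro h
      refine ⟨fun j => ?_, by simpa using h i⟩
      by_cases hj : j = i
      · subst hj; simp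
      · have := h j
        rwa [Function.update_of_ne hj] at this ⊢
    · rintro ⟨h1, h2⟩ j
      by_cases hj : j = i
      · subst hj; simpa using h2
      · have := h1 j
        rwa [Function.update_of_ne hj] at this ⊢
  rw [this, Measure.prod_prod, Measure.pi_pi, ← Finset.mul_prod_erase _ _ (Finset.mem_univ i),
    ← Finset.mul_prod_erase Finset.univ (fun j => D j (s j)) (Finset.mem_univ i)]
  simp only [Function.update_self, measure_univ, one_mul]
  rw [mul_comm]
  congr 1
  refine Finset.prod_congr rfl fun j hj => ?_
  rw [Function.update_of_ne (Finset.ne_of_mem_erase hj)]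

lemma measurable_update_pair {n : ℕ} (i : Fin n) :
    Measurable (fun q : (Fin n → ℝ) × ℝ => Function.update q.1 i q.2) := by
  rw [measurable_pi_iff]
  intro j
  by_cases h : j = i
  · subst h; simpa using measurable_snd
  · simp only [Function.update_of_ne h]
    exact (measurable_pi_apply j).comp measurable_fst

lemma integrable_update {n : ℕ} (D : Fin n → Measure ℝ) (hD : ∀ i, IsProbabilityMeasure (D i))
    (i : Fin n) (F : (Fin n → ℝ) → ℝ) (hF : Integrable F (Measure.pi D)) :
    Integrable (fun q : (Fin n → ℝ) × ℝ => F (Function.update q.1 i q.2))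
      ((Measure.pi D).prod (D i)) := by
  have h := pi_update_preserving D hD i
  rw [← h] at hF
  exact hF.comp_measurable (measurable_update_pair i)

lemma integral_update {n : ℕ} (D : Fin n → Measure ℝ) (hD : ∀ i, IsProbabilityMeasure (D i))
    (i : Fin n) (F : (Fin n → ℝ) → ℝ) (hF : Integrable F (Measure.pi D)) :
    ∫ v, F v ∂(Measure.pi D)
      = ∫ v, ∫ w, F (Function.update v i w) ∂(D i) ∂(Measure.pi D) := by
  rw [← integral_prod (fun q : (Fin n → ℝ) × ℝ => F (Function.update q.1 i q.2))
    (integrable_update D hD i F hF)]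
  have h := pi_update_preserving D hD i
  have hF' : AEStronglyMeasurable F (Measure.map
      (fun q : (Fin n → ℝ) × ℝ => Function.update q.1 i q.2) ((Measure.pi D).prod (D i))) := by
    rw [h]; exact hF.aestronglyMeasurable
  rw [← integral_map (measurable_update_pair i).aemeasurable hF', h]

/-! ### Grid and levels -/

/-- Geometric grid. -/
noncomputable def gr (ε : ℝ) (j : ℕ) : ℝ := Real.exp (ε * j)

/-- Level of a value, clipped at `k`. -/
noncomputable def lv (ε : ℝ) (k : ℕ) (w : ℝ) : ℕ := min ⌊Real.log w / ε⌋₊ k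

lemma gr_mono {ε : ℝ} (hε : 0 < ε) : Monotone (gr ε) := by
  intro a b hab
  unfold gr
  exact Real.exp_le_exp.2 (mul_le_mul_of_nonneg_left (by exact_mod_cast hab) hε.le)

lemma gr_pos (ε : ℝ) (j : ℕ) : 0 < gr ε j := Real.exp_pos _

lemma gr_zero (ε : ℝ) : gr ε 0 = 1 := by simp [gr]

lemma gr_succ (ε : ℝ) (j : ℕ) : gr ε (j+1) = Real.exp ε * gr ε j := by
  unfold gr; rw [← Real.exp_add]; push_cast; ring_nf

lemma lv_le (ε : ℝ) (k : ℕ) (w : ℝ) : lv ε k w ≤ k := min_le_right _ _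

lemma gr_lv_le {ε : ℝ} (hε : 0 < ε) (k : ℕ) {w : ℝ} (hw : 1 ≤ w) : gr ε (lv ε k w) ≤ w := by
  have h0 : 0 ≤ Real.log w / ε := div_nonneg (Real.log_nonneg hw) hε.le
  have h1 : gr ε (lv ε k w) ≤ gr ε ⌊Real.log w / ε⌋₊ := gr_mono hε (min_le_left _ _)
  refine h1.trans ?_
  unfold gr
  rw [← Real.le_log_iff_exp_le (by linarith)]
  have := Nat.floor_le h0
  rw [le_div_iff₀ hε] at this
  linarith

lemma lt_gr_floor {ε : ℝ} (hε : 0 < ε) {w : ℝ} (hw : 0 < w) : w < gr ε (⌊Real.log w / ε⌋₊ + 1) := by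
  unfold gr
  rw [← Real.log_lt_iff_lt_exp hw]
  have := Nat.lt_floor_add_one (Real.log w / ε)
  rw [div_lt_iff₀ hε] at this
  push_cast
  linarith

lemma lt_gr_lv {ε : ℝ} (hε : 0 < ε) {k : ℕ} {w : ℝ} (hw : 0 < w) (h : lv ε k w < k) :
    w < gr ε (lv ε k w + 1) := by
  have : lv ε k w = ⌊Real.log w / ε⌋₊ := by
    unfold lv at h ⊢; omega
  rw [this]; exact lt_gr_floor hε hw

lemma lt_gr_lv' {ε : ℝ} (hε : 0 < ε) {k : ℕ} {h w : ℝ} (hk : k = ⌊Real.log h / ε⌋₊)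
    (hw : 1 ≤ w) (hwh : w ≤ h) : w < gr ε (lv ε k w + 1) := by
  have : lv ε k w = ⌊Real.log w / ε⌋₊ := by
    unfold lv
    apply min_eq_left
    rw [hk]
    apply Nat.floor_le_floor
    exact div_le_div_of_nonneg_right (Real.log_le_log (by linarith) hwh) hε.le
  rw [this]; exact lt_gr_floor hε (by linarith)

lemma lv_mono {ε : ℝ} (hε : 0 < ε) (k : ℕ) {a b : ℝ} (ha : 0 < a) (hab : a ≤ b) :
    lv ε k a ≤ lv ε k b := by
  unfold lv
  apply min_le_min_right
  apply Nat.floor_le_floor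
  exact div_le_div_of_nonneg_right (Real.log_le_log ha hab) hε.le

lemma lv_meas (ε : ℝ) (k : ℕ) : Measurable (lv ε k) := by
  unfold lv
  exact (Nat.measurable_floor.comp (Real.measurable_log.div_const ε)).min measurable_const

/-! ### Rank mechanisms -/

/-- Buyer `i` with rank `a` wins against the ranks `c` of the others. -/
def Wins {n : ℕ} (c : Fin n → ℕ) (i : Fin n) (a : ℕ) : Prop :=
  0 < a ∧ ∀ j, j ≠ i → (c j < a ∨ (c j = a ∧ i < j))

lemma Wins.mono {n : ℕ} {c : Fin n → ℕ} {i : Fin n} {a b : ℕ} (h : Wins c i a) (hab : a ≤ b) :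
    Wins c i b := by
  refine ⟨h.1.trans_le hab, fun j hj => ?_⟩
  rcases h.2 j hj with h1 | ⟨h1, h2⟩
  · exact Or.inl (h1.trans_le hab)
  · rcases hab.lt_or_eq with h3 | h3
    · exact Or.inl (h1 ▸ h3)
    · exact Or.inr ⟨h1.trans h3, h2⟩

lemma Wins.congr {n : ℕ} {c c' : Fin n → ℕ} {i : Fin n} (hc : ∀ j, j ≠ i → c j = c' j) (a : ℕ) :
    Wins c i a ↔ Wins c' i a := by
  unfold Wins
  refine and_congr_right fun _ => forall_congr' fun j => forall_congr' fun hj => ?_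
  rw [hc j hj]

lemma Wins.unique {n : ℕ} {c : Fin n → ℕ} {i j : Fin n} (hi : Wins c i (c i)) (hj : Wins c j (c j)) :
    i = j := by
  by_contra hne
  have h1 := hi.2 j (Ne.symm hne)
  have h2 := hj.2 i hne
  omega

lemma Wins.exists {n : ℕ} (c : Fin n → ℕ) (i0 : Fin n) (h : 0 < c i0) : ∃ i, Wins c i (c i) := by
  obtain ⟨a, -, ha⟩ := Finset.exists_max_image Finset.univ c ⟨i0, Finset.mem_univ _⟩
  have hne : (Finset.univ.filter fun j => c j = c a).Nonempty := ⟨a, by simp⟩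
  obtain ⟨b, hb, hbmin⟩ := Finset.exists_min_image _ (fun j => j) hne
  simp only [Finset.mem_filter, Finset.mem_univ, true_and] at hb hbmin
  refine ⟨b, ?_, fun j hj => ?_⟩
  · rw [hb]; exact h.trans_le (ha i0 (Finset.mem_univ _))
  · have h1 := ha j (Finset.mem_univ _)
    rcases h1.lt_or_eq with h2 | h2
    · left; omega
    · right
      exact ⟨by omega, lt_of_le_of_ne (hbmin j h2) (Ne.symm hj)⟩

/-- Rank of every buyer. -/
noncomputable def rk {n : ℕ} (ε : ℝ) (k : ℕ) (r : Fin n → ℕ → ℕ) (v : Fin n → ℝ) (i : Fin n) : ℕ :=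
  if 1 ≤ v i then r i (lv ε k (v i)) else 0

open Classical in
/-- Allocate to the buyer of highest positive rank, at the threshold price. -/
noncomputable def rankMech {n : ℕ} (ε : ℝ) (k : ℕ) (r : Fin n → ℕ → ℕ) : Mech n where
  alloc v i := if Wins (rk ε k r v) i (rk ε k r v i) then 1 else 0
  pay v i := (if Wins (rk ε k r v) i (rk ε k r v i) then 1 else 0)
    * gr ε (sInf {l | Wins (rk ε k r v) i (r i l)})

lemma rk_update_ne {n : ℕ} (ε : ℝ) (k : ℕ) (r : Fin n → ℕ → ℕ) (v : Fin n → ℝ) (i : Fin n) (w : ℝ)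
    (j : Fin n) (hj : j ≠ i) : rk ε k r (Function.update v i w) j = rk ε k r v j := by
  unfold rk; rw [Function.update_of_ne hj]

lemma wins_update {n : ℕ} (ε : ℝ) (k : ℕ) (r : Fin n → ℕ → ℕ) (v : Fin n → ℝ) (i : Fin n) (w : ℝ)
    (a : ℕ) : Wins (rk ε k r (Function.update v i w)) i a ↔ Wins (rk ε k r v) i a :=
  Wins.congr (fun j hj => rk_update_ne ε k r v i w j hj) a

lemma rk_meas {n : ℕ} (ε : ℝ) (k : ℕ) (r : Fin n → ℕ → ℕ) : Measurable (rk ε k r) := by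
  rw [measurable_pi_iff]
  intro i
  unfold rk
  refine Measurable.ite (measurableSet_le measurable_const (measurable_pi_apply i)) ?_ measurable_const
  exact (measurable_of_countable (r i)).comp ((lv_meas ε k).comp (measurable_pi_apply i))

lemma wins_one_le {n : ℕ} {ε : ℝ} {k : ℕ} {r : Fin n → ℕ → ℕ} {v : Fin n → ℝ} {i : Fin n}
    (h : Wins (rk ε k r v) i (rk ε k r v i)) :
    1 ≤ v i ∧ Wins (rk ε k r v) i (r i (lv ε k (v i))) := by
  by_cases h1 : 1 ≤ v i
  · refine ⟨h1, ?_⟩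
    have h2 : rk ε k r v i = r i (lv ε k (v i)) := by simp [rk, h1]
    rwa [h2] at h
  · have h2 : rk ε k r v i = 0 := by simp [rk, h1]
    exact absurd h.1 (by omega)

lemma price_le_of_wins {n : ℕ} {ε : ℝ} (hε : 0 < ε) {k : ℕ} {r : Fin n → ℕ → ℕ} {v : Fin n → ℝ}
    {i : Fin n} (h : Wins (rk ε k r v) i (rk ε k r v i)) :
    gr ε (sInf {l | Wins (rk ε k r v) i (r i l)}) ≤ v i := by
  obtain ⟨h1, h2⟩ := wins_one_le h
  refine le_trans (gr_mono hε (Nat.sInf_le h2)) (gr_lv_le hε k h1)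

lemma rankMech_good {n : ℕ} {ε : ℝ} (hε : 0 < ε) (k : ℕ) (r : Fin n → ℕ → ℕ)
    (hr : ∀ i, Monotone (r i)) : (rankMech ε k r).Good := by
  classical
  refine ⟨?_, ?_, ?_, ?_⟩
  · intro v
    refine ⟨fun i => ?_, ?_⟩
    · simp only [rankMech]; split_ifs <;> norm_num
    · simp only [rankMech]
      by_cases h : ∃ i, Wins (rk ε k r v) i (rk ε k r v i)
      · obtain ⟨i, hi⟩ := h
        rw [Finset.sum_eq_single i]
        · split_ifs <;> norm_num
        · intro j _ hj
          rw [if_neg]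
          intro hj'
          exact hj (hj'.unique hi)
        · simp
      · push Not at h
        simp [h]
  · intro i v hv v' hv'
    simp only [rankMech]
    simp only [wins_update]
    set S := {l | Wins (rk ε k r v) i (r i l)} with hS
    by_cases h1 : Wins (rk ε k r v) i (rk ε k r (Function.update v i v') i)
    · by_cases h2 : Wins (rk ε k r v) i (rk ε k r v i)
      · simp [h1, h2]
      · simp only [h1, h2, if_true, if_false]
        have h3 := (wins_update ε k r v i v' _).2 h1
        obtain ⟨h4, h5⟩ := wins_one_le h3
        rw [wins_update, Function.update_self] at h5
        have h6 : sInf S ≤ k := (Nat.sInf_le h5).trans (lv_le _ _ _)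
        have h7 : sInf S ∈ S := Nat.sInf_mem ⟨_, h5⟩
        suffices v i ≤ gr ε (sInf S) by linarith
        by_cases h8 : 1 ≤ v i
        · have h9 : lv ε k (v i) < sInf S := by
            by_contra h10
            push Not at h10
            apply h2
            have h11 : rk ε k r v i = r i (lv ε k (v i)) := by simp [rk, h8]
            rw [h11]
            exact Wins.mono h7 (hr i h10)
          exact (lt_gr_lv hε (by linarith) (h9.trans_le h6)).le.trans (gr_mono hε h9)
        · have := gr_mono hε (Nat.zero_le (sInf S))
          rw [gr_zero] at this
          linarith
    · by_cases h2 : Wins (rk ε k r v) i (rk ε k r v i)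
      · simp only [h1, h2, if_true, if_false]
        have := price_le_of_wins hε h2
        linarith
      · simp [h1, h2]
  · intro v hv i
    simp only [rankMech]
    by_cases h2 : Wins (rk ε k r v) i (rk ε k r v i)
    · simp only [h2, if_true]
      have := price_le_of_wins hε h2
      linarith
    · simp [h2]
  · constructor
    · intro i
      exact (measurable_of_countable (fun c : Fin n → ℕ => if Wins c i (c i) then (1:ℝ) else 0)).comp
        (rk_meas ε k r)
    · intro i
      exact (measurable_of_countable (fun c : Fin n → ℕ => (if Wins c i (c i) then (1:ℝ) else 0)
        * gr ε (sInf {l | Wins c i (r i l)}))).comp (rk_meas ε k r)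

lemma rankMech_pay_nonneg {n : ℕ} (ε : ℝ) (k : ℕ) (r : Fin n → ℕ → ℕ) (v : Fin n → ℝ) (i : Fin n) :
    0 ≤ (rankMech ε k r).pay v i := by
  classical
  simp only [rankMech]
  exact mul_nonneg (by split_ifs <;> norm_num) (gr_pos _ _).le

/-- Revenue on a profile bounded by `h` is at most `h`, for any good mechanism. -/
lemma sum_pay_le {n : ℕ} {M : Mech n} (hM : M.Good) {h : ℝ} {v : Fin n → ℝ}
    (hv : ∀ i, 1 ≤ v i ∧ v i ≤ h) (hh : 0 ≤ h) : ∑ i, M.pay v i ≤ h := by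
  have h1 : ∀ i, M.pay v i ≤ h * M.alloc v i := by
    intro i
    have := hM.2.2.1 v (fun j => by linarith [(hv j).1]) i
    have h2 := mul_le_mul_of_nonneg_right (hv i).2 ((hM.1 v).1 i).1
    linarith
  calc ∑ i, M.pay v i ≤ ∑ i, h * M.alloc v i := Finset.sum_le_sum fun i _ => h1 i
    _ = h * ∑ i, M.alloc v i := by rw [Finset.mul_sum]
    _ ≤ h * 1 := mul_le_mul_of_nonneg_left (hM.1 v).2 hh
    _ = h := mul_one h

open Classical in
/-- Post price `1` to a single buyer. -/
noncomputable def postOne {n : ℕ} (i0 : Fin n) : Mech n where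
  alloc v i := if i = i0 ∧ 1 ≤ v i0 then 1 else 0
  pay v i := if i = i0 ∧ 1 ≤ v i0 then 1 else 0

lemma postOne_good {n : ℕ} (i0 : Fin n) : (postOne i0).Good := by
  classical
  have hm : ∀ i, Measurable fun v : Fin n → ℝ => if i = i0 ∧ 1 ≤ v i0 then (1:ℝ) else 0 := by
    intro i
    refine Measurable.ite ?_ measurable_const measurable_const
    by_cases h : i = i0
    · simp only [h, true_and]
      exact measurableSet_le measurable_const (measurable_pi_apply i0)
    · simp [h]
  refine ⟨fun v => ⟨fun i => ?_, ?_⟩, ?_, ?_, hm, hm⟩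
  · simp only [postOne]; split_ifs <;> norm_num
  · simp only [postOne]
    rw [Finset.sum_eq_single i0]
    · split_ifs <;> norm_num
    · intro j _ hj; simp [hj]
    · simp
  · intro i v hv v' hv'
    simp only [postOne]
    by_cases h : i = i0
    · subst h
      simp only [true_and, Function.update_self]
      split_ifs <;> linarith
    · simp [h]
  · intro v hv i
    simp only [postOne]
    by_cases h : i = i0
    · subst h
      simp only [true_and]
      split_ifs <;> linarith
    · simp [h]

/-! ### Supports -/

lemma supp_ae {n : ℕ} {D : Fin n → Measure ℝ} (hD : ∀ i, IsProbabilityMeasure (D i)) {h : ℝ}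
    (hs : ∀ i, D i ((Set.Icc (1 : ℝ) h)ᶜ) = 0) :
    ∀ᵐ v ∂(Measure.pi D), ∀ i, 1 ≤ v i ∧ v i ≤ h := by
  rw [ae_all_iff]
  intro i
  have h1 : ∀ᵐ w ∂(D i), 1 ≤ w ∧ w ≤ h := by
    rw [ae_iff]; exact hs i
  exact (Measure.tendsto_eval_ae_ae (μ := D) (i := i)).eventually h1

lemma postOne_rev {n : ℕ} (i0 : Fin n) {D : Fin n → Measure ℝ}
    (hD : ∀ i, IsProbabilityMeasure (D i)) {h : ℝ}
    (hs : ∀ i, D i ((Set.Icc (1 : ℝ) h)ᶜ) = 0) : Rev (postOne i0) (Measure.pi D) = 1 := by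
  unfold Rev
  have : ∀ᵐ v ∂(Measure.pi D), ∑ i, (postOne i0).pay v i = 1 := by
    filter_upwards [supp_ae hD hs] with v hv
    simp [postOne, (hv i0).1]
  rw [integral_congr_ae this]
  simp

lemma rev_le {n : ℕ} {M : Mech n} (hM : M.Good) {D : Fin n → Measure ℝ}
    (hD : ∀ i, IsProbabilityMeasure (D i)) {h : ℝ} (hh : 0 ≤ h)
    (hs : ∀ i, D i ((Set.Icc (1 : ℝ) h)ᶜ) = 0) : Rev M (Measure.pi D) ≤ h := by
  unfold Rev
  by_cases hi : Integrable (fun v => ∑ i, M.pay v i) (Measure.pi D)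
  · have := integral_mono_ae hi (integrable_const h)
      (by filter_upwards [supp_ae hD hs] with v hv; exact sum_pay_le hM hv hh)
    simpa using this
  · rw [integral_undef hi]; exact hh

/-! ### Comparison of revenue and virtual surplus -/

lemma integral_mono_update {n : ℕ} (D : Fin n → Measure ℝ) (hD : ∀ i, IsProbabilityMeasure (D i))
    (i : Fin n) (F G : (Fin n → ℝ) → ℝ) (hF : Integrable F (Measure.pi D))
    (hG : Integrable G (Measure.pi D))
    (hle : ∀ᵐ v ∂(Measure.pi D), ∫ w, F (Function.update v i w) ∂(D i)
      ≤ ∫ w, G (Function.update v i w) ∂(D i)) :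
    ∫ v, F v ∂(Measure.pi D) ≤ ∫ v, G v ∂(Measure.pi D) := by
  rw [integral_update D hD i F hF, integral_update D hD i G hG]
  exact integral_mono_ae (integrable_update D hD i F hF).integral_prod_left
    (integrable_update D hD i G hG).integral_prod_left hle

lemma ironing' (k : ℕ) (f g : ℕ → ℝ) (hf : ∀ j, 0 ≤ f j) (hg : Monotone g) (hg0 : 0 ≤ g 0) :
    ∃ y : ℕ → ℝ, Monotone y ∧ (∀ j, 0 ≤ y j) ∧ (∀ j, y j = y (min j k)) ∧
      (∀ X : ℕ → ℝ, Monotone X → (∀ j, 0 ≤ X j) →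
        revFun k f g X ≤ ∑ j ∈ Finset.range (k+1), f j * X j * y j) ∧
      (∀ t : ℕ, 0 < y t → (∀ l < t, y l < y t) →
        ∑ j ∈ Finset.range (k+1), f j * (if t ≤ j then 1 else 0) * y j
          ≤ revFun k f g (fun j => if t ≤ j then 1 else 0)) := by
  obtain ⟨y, h1, h2, h3, h4⟩ := ironing k f g hf hg hg0
  have hs : ∀ X : ℕ → ℝ, ∑ j ∈ Finset.range (k+1), f j * X j * y (min j k)
      = ∑ j ∈ Finset.range (k+1), f j * X j * y j := by
    intro X
    refine Finset.sum_congr rfl fun j hj => ?_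
    rw [min_eq_left (by simpa [Nat.lt_succ_iff] using hj)]
  refine ⟨fun j => y (min j k), fun a b hab => h1 (min_le_min_right k hab), fun j => h2 _,
    fun j => by simp, ?_, ?_⟩
  · intro X hX hX0
    simp only [hs]
    exact h3 X hX hX0
  · intro t ht hlt
    simp only [hs]
    have htk : t ≤ k := by
      by_contra hc
      push Not at hc
      have := hlt k hc
      simp [min_eq_right hc.le] at this
    beta_reduce at ht
    rw [min_eq_left htk] at ht
    refine h4 t ht fun l hl => ?_
    have := hlt l hl
    beta_reduce at this
    rwa [min_eq_left htk, min_eq_left (hl.le.trans htk)] at this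

lemma pay_pointwise {ε : ℝ} (hε : 0 < ε) (x p : ℝ → ℝ) (hx0 : ∀ a, 0 ≤ x a)
    (hic : ∀ a b, 0 ≤ a → 0 ≤ b → a * x b - p b ≤ a * x a - p a)
    (hir : ∀ a, 0 ≤ a → 0 ≤ a * x a - p a)
    (hmono : ∀ a b, 0 ≤ a → a ≤ b → x a ≤ x b) (j : ℕ) (w : ℝ) (hw : gr ε j ≤ w)
    (hw' : w ≤ gr ε (j+1)) :
    p w ≤ gr ε (j+1) * x w
      - ∑ l ∈ Finset.range j, (gr ε (l+2) - gr ε (l+1)) * x (gr ε (l+1)) := by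
  have key : ∀ j : ℕ, ∑ l ∈ Finset.range j, (gr ε (l+2) - gr ε (l+1)) * x (gr ε (l+1))
      - (gr ε (j+1) - gr ε j) * x (gr ε j) ≤ gr ε j * x (gr ε j) - p (gr ε j) := by
    intro j
    induction j with
    | zero =>
      have h1 := hir (gr ε 0) (gr_pos _ _).le
      have h2 := mul_nonneg (sub_nonneg.2 (gr_mono hε (Nat.zero_le (0+1)))) (hx0 (gr ε 0))
      simp only [Finset.range_zero, Finset.sum_empty]
      linarith
    | succ j ih =>
      rw [Finset.sum_range_succ]
      have h1 := hic (gr ε (j+1)) (gr ε j) (gr_pos _ _).le (gr_pos _ _).le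
      linarith
  have h1 := key j
  have h2 := hic w (gr ε j) ((gr_pos _ _).le.trans hw) (gr_pos _ _).le
  have h3 := hmono (gr ε j) w (gr_pos _ _).le hw
  have h4 := mul_le_mul_of_nonneg_left h3 (sub_nonneg.2 hw')
  linarith

lemma oneD_upper {ε : ℝ} (hε : 0 < ε) {h : ℝ} {k : ℕ} (hk : k = ⌊Real.log h / ε⌋₊)
    (μ : Measure ℝ) [IsProbabilityMeasure μ] (hsupp : ∀ᵐ w ∂μ, 1 ≤ w ∧ w ≤ h)
    (x : ℝ → ℝ) (hxm : Measurable x) (hx : ∀ a, 0 ≤ x a ∧ x a ≤ 1)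
    (hmono : ∀ a b, 0 ≤ a → a ≤ b → x a ≤ x b) (y : ℕ → ℝ)
    (hy : ∀ X : ℕ → ℝ, Monotone X → (∀ j, 0 ≤ X j) →
        revFun k (fun j => μ.real {w | lv ε k w = j}) (gr ε) X
          ≤ ∑ j ∈ Finset.range (k+1), μ.real {w | lv ε k w = j} * X j * y j) :
    ∫ w, (gr ε (lv ε k w + 1) * x w
      - ∑ l ∈ Finset.range (lv ε k w), (gr ε (l+2) - gr ε (l+1)) * x (gr ε (l+1))) ∂μ
      ≤ Real.exp ε * ∫ w, y (lv ε k w) * x w ∂μ := by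
  have hxi : Integrable x μ := Integrable.of_bound hxm.aestronglyMeasurable 1
    (Filter.Eventually.of_forall fun w => by
      rw [Real.norm_eq_abs, abs_of_nonneg (hx w).1]; exact (hx w).2)
  set f : ℕ → ℝ := fun j => μ.real {w | lv ε k w = j} with hf
  have hms : ∀ j, MeasurableSet {w | lv ε k w = j} := fun j => lv_meas ε k (measurableSet_singleton j)
  set I : ℕ → ℝ := fun j => ∫ w in {w | lv ε k w = j}, x w ∂μ with hI
  have hfnn : ∀ j, 0 ≤ f j := fun j => measureReal_nonneg
  have hIle : ∀ j, I j ≤ f j * x (gr ε (j+1)) := by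
    intro j
    have : I j ≤ ∫ w in {w | lv ε k w = j}, x (gr ε (j+1)) ∂μ := by
      refine setIntegral_mono_on_ae hxi.integrableOn (integrable_const _).integrableOn (hms j) ?_
      filter_upwards [hsupp] with w hw hwj
      have hwj' : lv ε k w = j := hwj
      refine hmono _ _ (by linarith) ?_
      rw [← hwj']
      exact (lt_gr_lv' hε hk hw.1 hw.2).le
    simpa [hf] using this
  have hIge : ∀ j, f j * x (gr ε j) ≤ I j := by
    intro j
    have : ∫ w in {w | lv ε k w = j}, x (gr ε j) ∂μ ≤ I j := by
      refine setIntegral_mono_on_ae (integrable_const _).integrableOn hxi.integrableOn (hms j) ?_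
      filter_upwards [hsupp] with w hw hwj
      have hwj' : lv ε k w = j := hwj
      refine hmono _ _ (gr_pos _ _).le ?_
      rw [← hwj']
      exact gr_lv_le hε k hw.1
    simpa [hf] using this
  set X : ℕ → ℝ := fun j => if f j = 0 then x (gr ε j) else I j / f j with hX
  have hfX : ∀ j, f j * X j = I j := by
    intro j
    simp only [hX]
    split_ifs with h0
    · have h1 := hIle j
      have h2 := hIge j
      rw [h0] at h1 h2 ⊢
      linarith
    · field_simp
  have hXge : ∀ j, x (gr ε j) ≤ X j := by
    intro j
    simp only [hX]
    split_ifs with h0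
    · exact le_rfl
    · rw [le_div_iff₀ (lt_of_le_of_ne (hfnn j) (Ne.symm h0))]
      linarith [hIge j]
  have hXle : ∀ j, X j ≤ x (gr ε (j+1)) := by
    intro j
    simp only [hX]
    split_ifs with h0
    · exact hmono _ _ (gr_pos _ _).le (gr_mono hε (Nat.le_succ j))
    · rw [div_le_iff₀ (lt_of_le_of_ne (hfnn j) (Ne.symm h0))]
      linarith [hIle j]
  have hXm : Monotone X := monotone_nat_of_le_succ fun j => (hXle j).trans (hXge (j+1))
  have hX0 : ∀ j, 0 ≤ X j := fun j => (hx _).1.trans (hXge j)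
  have e1 : ∫ w, gr ε (lv ε k w + 1) * x w ∂μ
      = ∑ j ∈ Finset.range (k+1), gr ε (j+1) * (f j * X j) := by
    rw [integral_levels μ k (lv ε k) (lv_meas ε k) (lv_le ε k) (fun j => gr ε (j+1)) x hxi]
    exact Finset.sum_congr rfl fun j _ => by rw [hfX]
  have e2 : ∫ w, y (lv ε k w) * x w ∂μ = ∑ j ∈ Finset.range (k+1), f j * X j * y j := by
    rw [integral_levels μ k (lv ε k) (lv_meas ε k) (lv_le ε k) y x hxi]
    exact Finset.sum_congr rfl fun j _ => by rw [hfX]; ring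
  have e3 := integral_levels_one μ k (lv ε k) (lv_meas ε k) (lv_le ε k)
    (fun j => ∑ l ∈ Finset.range j, (gr ε (l+2) - gr ε (l+1)) * x (gr ε (l+1)))
  have bnd : ∀ φ : ℕ → ℝ, Integrable (fun w => φ (lv ε k w)) μ := by
    intro φ
    refine Integrable.of_bound
      ((measurable_of_countable φ).comp (lv_meas ε k)).aestronglyMeasurable
      (∑ j ∈ Finset.range (k+1), ‖φ j‖) (Filter.Eventually.of_forall fun w => ?_)
    exact Finset.single_le_sum (f := fun j => ‖φ j‖) (fun j _ => norm_nonneg _)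
      (Finset.mem_range.2 (Nat.lt_succ_of_le (lv_le ε k w)))
  have i1 : Integrable (fun w => gr ε (lv ε k w + 1) * x w) μ := by
    refine (bnd fun j => gr ε (j+1)).mul_bdd (c := 1) hxm.aestronglyMeasurable
      (Filter.Eventually.of_forall fun w => ?_)
    rw [Real.norm_eq_abs, abs_of_nonneg (hx w).1]; exact (hx w).2
  rw [integral_sub i1 (bnd fun j => ∑ l ∈ Finset.range j,
    (gr ε (l+2) - gr ε (l+1)) * x (gr ε (l+1))), e1, e2, e3]
  refine le_trans ?_ (mul_le_mul_of_nonneg_left (hy X hXm hX0) (Real.exp_pos ε).le)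
  unfold revFun
  rw [Finset.mul_sum, ← Finset.sum_sub_distrib]
  refine Finset.sum_le_sum fun j _ => ?_
  have hs : Real.exp ε * ∑ l ∈ Finset.range j, (gr ε (l+1) - gr ε l) * X l
      ≤ ∑ l ∈ Finset.range j, (gr ε (l+2) - gr ε (l+1)) * x (gr ε (l+1)) := by
    rw [Finset.mul_sum]
    refine Finset.sum_le_sum fun l _ => ?_
    rw [gr_succ ε (l+1)]
    have h1 := mul_le_mul_of_nonneg_left (hXle l)
      (mul_nonneg (Real.exp_pos ε).le (sub_nonneg.2 (gr_mono hε (Nat.le_succ l))))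
    have h2 : gr ε (l+1) = Real.exp ε * gr ε l := gr_succ ε l
    calc Real.exp ε * ((gr ε (l+1) - gr ε l) * X l)
        = Real.exp ε * (gr ε (l+1) - gr ε l) * X l := by ring
      _ ≤ Real.exp ε * (gr ε (l+1) - gr ε l) * x (gr ε (l+1)) := h1
      _ = (Real.exp ε * gr ε (l+1) - Real.exp ε * gr ε l) * x (gr ε (l+1)) := by ring
      _ = _ := by rw [← h2]
  have := mul_le_mul_of_nonneg_left hs (hfnn j)
  rw [gr_succ ε j]
  change _ ≤ Real.exp ε * (f j * _)
  linarith

lemma oneD_lower {n : ℕ} {ε : ℝ} {h : ℝ} {k : ℕ}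
    (μ : Measure ℝ) [IsProbabilityMeasure μ] (hsupp : ∀ᵐ w ∂μ, 1 ≤ w ∧ w ≤ h)
    (r : Fin n → ℕ → ℕ) (hr : ∀ i, Monotone (r i)) (v : Fin n → ℝ) (i : Fin n) (y : ℕ → ℝ)
    (hpos : ∀ l, 0 < r i l → 0 < y l) (hord : ∀ a b, r i a < r i b → y a < y b)
    (hy : ∀ t : ℕ, 0 < y t → (∀ l < t, y l < y t) →
        ∑ j ∈ Finset.range (k+1), μ.real {w | lv ε k w = j} * (if t ≤ j then 1 else 0) * y j
          ≤ revFun k (fun j => μ.real {w | lv ε k w = j}) (gr ε) (fun j => if t ≤ j then 1 else 0)) :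
    ∫ w, (rankMech ε k r).alloc (Function.update v i w) i * y (lv ε k w) ∂μ
      ≤ ∫ w, (rankMech ε k r).pay (Function.update v i w) i ∂μ := by
  classical
  simp only [rankMech, wins_update]
  set S := {l | Wins (rk ε k r v) i (r i l)} with hS
  have hrk : ∀ w, 1 ≤ w → rk ε k r (Function.update v i w) i = r i (lv ε k w) := by
    intro w hw; simp [rk, hw]
  by_cases hne : S.Nonempty
  · set t := sInf S with ht
    have htS : t ∈ S := Nat.sInf_mem hne
    have hiff : ∀ l, Wins (rk ε k r v) i (r i l) ↔ t ≤ l := fun l =>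
      ⟨fun hl => Nat.sInf_le hl, fun hl => Wins.mono htS (hr i hl)⟩
    have e1 : ∫ w, (if Wins (rk ε k r v) i (rk ε k r (Function.update v i w) i) then (1:ℝ) else 0)
        * y (lv ε k w) ∂μ
        = ∫ w, (fun j => (if t ≤ j then (1:ℝ) else 0) * y j) (lv ε k w) ∂μ := by
      refine integral_congr_ae ?_
      filter_upwards [hsupp] with w hw
      rw [hrk w hw.1]
      simp only [hiff]
    have e2 : ∫ w, (if Wins (rk ε k r v) i (rk ε k r (Function.update v i w) i) then (1:ℝ) else 0)
        * gr ε t ∂μ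
        = ∫ w, (fun j => gr ε j * (if t ≤ j then (1:ℝ) else 0)
          - ∑ l ∈ Finset.range j, (gr ε (l+1) - gr ε l) * (if t ≤ l then 1 else 0)) (lv ε k w) ∂μ := by
      refine integral_congr_ae ?_
      filter_upwards [hsupp] with w hw
      rw [hrk w hw.1]
      simp only [hiff]
      rw [threshold_telescope]
    rw [e1, e2, integral_levels_one μ k (lv ε k) (lv_meas ε k) (lv_le ε k)
        (fun j => (if t ≤ j then (1:ℝ) else 0) * y j),
      integral_levels_one μ k (lv ε k) (lv_meas ε k) (lv_le ε k)
        (fun j => gr ε j * (if t ≤ j then (1:ℝ) else 0)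
          - ∑ l ∈ Finset.range j, (gr ε (l+1) - gr ε l) * (if t ≤ l then 1 else 0))]
    have := hy t (hpos t htS.1) (fun l hl => hord l t (by
      by_contra hc
      push Not at hc
      exact absurd ((hiff l).1 (Wins.mono htS hc)) (by omega)))
    unfold revFun at this
    refine le_trans (le_of_eq ?_) this
    exact Finset.sum_congr rfl fun j _ => by ring
  · rw [Set.not_nonempty_iff_eq_empty] at hne
    have hno : ∀ l, ¬ Wins (rk ε k r v) i (r i l) := fun l hl => by
      have : l ∈ S := hl
      rw [hne] at this; exact this
    refine le_of_eq (integral_congr_ae ?_)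
    filter_upwards [hsupp] with w hw
    rw [hrk w hw.1]
    simp [hno]

lemma alloc_mono {n : ℕ} {M : Mech n} (hM : M.Good) (v : Fin n → ℝ) (hv : ∀ j, 0 ≤ v j) (i : Fin n) :
    (∀ a b, 0 ≤ a → 0 ≤ b → a * M.alloc (Function.update v i b) i - M.pay (Function.update v i b) i
      ≤ a * M.alloc (Function.update v i a) i - M.pay (Function.update v i a) i) ∧
    (∀ a, 0 ≤ a → 0 ≤ a * M.alloc (Function.update v i a) i - M.pay (Function.update v i a) i) ∧
    (∀ a b, 0 ≤ a → a ≤ b →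
      M.alloc (Function.update v i a) i ≤ M.alloc (Function.update v i b) i) := by
  have hu : ∀ a, 0 ≤ a → ∀ j, 0 ≤ Function.update v i a j := by
    intro a ha j
    by_cases hj : j = i
    · subst hj; simpa using ha
    · rw [Function.update_of_ne hj]; exact hv j
  have h1 : ∀ a b, 0 ≤ a → 0 ≤ b →
      a * M.alloc (Function.update v i b) i - M.pay (Function.update v i b) i
      ≤ a * M.alloc (Function.update v i a) i - M.pay (Function.update v i a) i := by
    intro a b ha hb
    have := hM.2.1 i (Function.update v i a) (hu a ha) b hb
    simpa using this
  refine ⟨h1, fun a ha => ?_, fun a b ha hab => ?_⟩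
  · have := hM.2.2.1 (Function.update v i a) (hu a ha) i
    simpa using this
  · have h2 := h1 a b ha (ha.trans hab)
    have h3 := h1 b a (ha.trans hab) ha
    rcases hab.lt_or_eq with h | h
    · nlinarith
    · rw [h]

lemma ae_integrable_pi {n : ℕ} (D : Fin n → Measure ℝ) (hD : ∀ i, IsProbabilityMeasure (D i))
    (F : (Fin n → ℝ) → ℝ) (hF : Measurable F) (c : ℝ) (hc : ∀ᵐ v ∂(Measure.pi D), |F v| ≤ c) :
    Integrable F (Measure.pi D) :=
  Integrable.of_bound hF.aestronglyMeasurable c hc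

lemma upper_buyer {n : ℕ} {ε : ℝ} (hε : 0 < ε) {h : ℝ} {k : ℕ} (hk : k = ⌊Real.log h / ε⌋₊)
    (D : Fin n → Measure ℝ) (hD : ∀ i, IsProbabilityMeasure (D i))
    (hs : ∀ i, D i ((Set.Icc (1 : ℝ) h)ᶜ) = 0) {M : Mech n} (hM : M.Good) (i : Fin n)
    (y : ℕ → ℝ) (hy0 : ∀ j, 0 ≤ y j) (hym : Monotone y)
    (hy : ∀ X : ℕ → ℝ, Monotone X → (∀ j, 0 ≤ X j) →
        revFun k (fun j => (D i).real {w | lv ε k w = j}) (gr ε) X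
          ≤ ∑ j ∈ Finset.range (k+1), (D i).real {w | lv ε k w = j} * X j * y j) :
    ∃ B : (Fin n → ℝ) → ℝ, Integrable B (Measure.pi D) ∧
      (∀ᵐ v ∂(Measure.pi D), M.pay v i ≤ B v) ∧
      ∫ v, B v ∂(Measure.pi D)
        ≤ ∫ v, Real.exp ε * (y (lv ε k (v i)) * M.alloc v i) ∂(Measure.pi D) := by
  have hx := fun v => (hM.1 v).1 i
  have hxm : Measurable fun v => M.alloc v i := hM.2.2.2.1 i
  have hupd : ∀ c : ℝ, Measurable fun v : Fin n → ℝ => Function.update v i c := fun c =>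
    (measurable_update_pair i).comp (measurable_id.prodMk measurable_const)
  have hlvi : Measurable fun v : Fin n → ℝ => lv ε k (v i) :=
    (lv_meas ε k).comp (measurable_pi_apply i)
  set B : (Fin n → ℝ) → ℝ := fun v => gr ε (lv ε k (v i) + 1) * M.alloc v i
      - ∑ l ∈ Finset.range (lv ε k (v i)), (gr ε (l+2) - gr ε (l+1))
        * M.alloc (Function.update v i (gr ε (l+1))) i with hB
  have hBm : Measurable B := by
    refine Measurable.sub (((measurable_of_countable fun j => gr ε (j+1)).comp hlvi).mul hxm) ?_
    have : Measurable (fun q : ℕ × (Fin n → ℝ) => ∑ l ∈ Finset.range q.1, (gr ε (l+2) - gr ε (l+1))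
        * M.alloc (Function.update q.2 i (gr ε (l+1))) i) := by
      refine measurable_from_prod_countable_right fun j => ?_
      refine Finset.measurable_sum (Finset.range j) fun l _ => ?_
      exact Measurable.const_mul (hxm.comp (hupd (gr ε (l+1)))) _
    exact this.comp (hlvi.prodMk measurable_id)
  have hBb : ∀ v, |B v| ≤ gr ε (k+1) := by
    intro v
    have h1 : 0 ≤ gr ε (lv ε k (v i) + 1) * M.alloc v i := mul_nonneg (gr_pos _ _).le (hx v).1
    have h2 : gr ε (lv ε k (v i) + 1) * M.alloc v i ≤ gr ε (k+1) := by
      have h3 := mul_le_mul_of_nonneg_left (hx v).2 (gr_pos ε (lv ε k (v i) + 1)).le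
      have h4 := gr_mono hε (Nat.add_le_add_right (lv_le ε k (v i)) 1)
      linarith
    have h5 : ∀ l, 0 ≤ gr ε (l+2) - gr ε (l+1) := fun l => sub_nonneg.2 (gr_mono hε (by omega))
    have h6 : 0 ≤ ∑ l ∈ Finset.range (lv ε k (v i)), (gr ε (l+2) - gr ε (l+1))
        * M.alloc (Function.update v i (gr ε (l+1))) i :=
      Finset.sum_nonneg fun l _ => mul_nonneg (h5 l) (hx _).1
    have h7 : ∑ l ∈ Finset.range (lv ε k (v i)), (gr ε (l+2) - gr ε (l+1))
        * M.alloc (Function.update v i (gr ε (l+1))) i ≤ gr ε (k+1) := by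
      calc _ ≤ ∑ l ∈ Finset.range (lv ε k (v i)), (gr ε (l+1+1) - gr ε (l+1)) :=
            Finset.sum_le_sum fun l _ => mul_le_of_le_one_right (h5 l) (hx _).2
        _ = gr ε (lv ε k (v i) + 1) - gr ε (0+1) :=
            Finset.sum_range_sub (fun l => gr ε (l+1)) _
        _ ≤ gr ε (k+1) := by
            have h4 := gr_mono hε (Nat.add_le_add_right (lv_le ε k (v i)) 1)
            have := gr_pos ε (0+1)
            linarith
    rw [abs_le]
    constructor <;> simp only [hB] <;> linarith
  have hBi : Integrable B (Measure.pi D) :=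
    ae_integrable_pi D hD B hBm _ (Filter.Eventually.of_forall hBb)
  have hGm : Measurable fun v : Fin n → ℝ => Real.exp ε * (y (lv ε k (v i)) * M.alloc v i) :=
    (((measurable_of_countable y).comp hlvi).mul hxm).const_mul _
  have hGi : Integrable (fun v : Fin n → ℝ => Real.exp ε * (y (lv ε k (v i)) * M.alloc v i))
      (Measure.pi D) := by
    refine ae_integrable_pi D hD _ hGm (Real.exp ε * y k) (Filter.Eventually.of_forall fun v => ?_)
    rw [abs_of_nonneg (mul_nonneg (Real.exp_pos ε).le (mul_nonneg (hy0 _) (hx v).1))]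
    refine mul_le_mul_of_nonneg_left ?_ (Real.exp_pos ε).le
    exact (mul_le_of_le_one_right (hy0 _) (hx v).2).trans (hym (lv_le ε k _))
  refine ⟨B, hBi, ?_, ?_⟩
  · filter_upwards [supp_ae hD hs] with v hv
    have hv0 : ∀ j, 0 ≤ v j := fun j => by linarith [(hv j).1]
    obtain ⟨h1, h2, h3⟩ := alloc_mono hM v hv0 i
    have := pay_pointwise hε (fun a => M.alloc (Function.update v i a) i)
      (fun a => M.pay (Function.update v i a) i) (fun a => (hx _).1) h1 h2 h3
      (lv ε k (v i)) (v i) (gr_lv_le hε k (hv i).1) (lt_gr_lv' hε hk (hv i).1 (hv i).2).le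
    simpa [hB] using this
  · refine integral_mono_update D hD i B _ hBi hGi ?_
    filter_upwards [supp_ae hD hs] with v hv
    have hv0 : ∀ j, 0 ≤ v j := fun j => by linarith [(hv j).1]
    obtain ⟨h1, h2, h3⟩ := alloc_mono hM v hv0 i
    have hsupp : ∀ᵐ w ∂(D i), 1 ≤ w ∧ w ≤ h := by
      rw [ae_iff]; exact hs i
    have hxm' : Measurable fun a : ℝ => M.alloc (Function.update v i a) i :=
      hxm.comp ((measurable_update_pair i).comp (measurable_const.prodMk measurable_id))
    have := oneD_upper hε hk (D i) hsupp (fun a => M.alloc (Function.update v i a) i) hxm'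
      (fun a => hx _) h3 y hy
    rw [integral_const_mul]
    simpa [hB] using this

lemma surplus_pointwise {n : ℕ} {ε : ℝ} (k : ℕ) (r : Fin n → ℕ → ℕ) (y : Fin n → ℕ → ℝ)
    (hy0 : ∀ i j, 0 ≤ y i j) (hpos : ∀ i l, 0 < y i l → 0 < r i l)
    (hord : ∀ i a j b, r i a ≤ r j b → y i a ≤ y j b) (v : Fin n → ℝ) (hv : ∀ i, 1 ≤ v i)
    (x : Fin n → ℝ) (hx : ∀ i, 0 ≤ x i) (hxs : ∑ i, x i ≤ 1) :
    ∑ i, y i (lv ε k (v i)) * x i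
      ≤ ∑ i, (rankMech ε k r).alloc v i * y i (lv ε k (v i)) := by
  classical
  have hrk : ∀ i, rk ε k r v i = r i (lv ε k (v i)) := fun i => by simp [rk, hv i]
  by_cases h : ∃ i, 0 < y i (lv ε k (v i))
  · obtain ⟨i0, hi0⟩ := h
    obtain ⟨i, hi⟩ := Wins.exists (rk ε k r v) i0 (by rw [hrk]; exact hpos _ _ hi0)
    have hmax : ∀ j, y j (lv ε k (v j)) ≤ y i (lv ε k (v i)) := by
      intro j
      by_cases hj : j = i
      · rw [hj]
      · apply hord
        rw [← hrk, ← hrk]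
        rcases hi.2 j hj with h1 | h1
        · exact h1.le
        · exact h1.1.le
    calc ∑ j, y j (lv ε k (v j)) * x j ≤ ∑ j, y i (lv ε k (v i)) * x j :=
          Finset.sum_le_sum fun j _ => mul_le_mul_of_nonneg_right (hmax j) (hx j)
      _ = y i (lv ε k (v i)) * ∑ j, x j := by rw [Finset.mul_sum]
      _ ≤ y i (lv ε k (v i)) * 1 := mul_le_mul_of_nonneg_left hxs (hy0 _ _)
      _ = (rankMech ε k r).alloc v i * y i (lv ε k (v i)) := by simp [rankMech, hi]
      _ ≤ _ := Finset.single_le_sum (f := fun i => (rankMech ε k r).alloc v i * y i (lv ε k (v i)))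
          (fun j _ => mul_nonneg (by simp only [rankMech]; split_ifs <;> norm_num) (hy0 _ _))
          (Finset.mem_univ i)
  · push Not at h
    have h0 : ∀ i, y i (lv ε k (v i)) = 0 := fun i => le_antisymm (h i) (hy0 _ _)
    simp [h0]

lemma rankMech_pay_integrable {n : ℕ} {ε : ℝ} (hε : 0 < ε) {h : ℝ} (k : ℕ)
    (D : Fin n → Measure ℝ) (hD : ∀ i, IsProbabilityMeasure (D i))
    (hs : ∀ i, D i ((Set.Icc (1 : ℝ) h)ᶜ) = 0) (r : Fin n → ℕ → ℕ) (hr : ∀ i, Monotone (r i))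
    (i : Fin n) : Integrable (fun v => (rankMech ε k r).pay v i) (Measure.pi D) := by
  have hG := rankMech_good hε k r hr
  refine ae_integrable_pi D hD _ (hG.2.2.2.2 i) h ?_
  filter_upwards [supp_ae hD hs] with v hv
  rw [abs_of_nonneg (rankMech_pay_nonneg ε k r v i)]
  have h0 : 0 ≤ h := by linarith [(hv i).1, (hv i).2]
  exact (Finset.single_le_sum (f := fun i => (rankMech ε k r).pay v i)
    (fun j _ => rankMech_pay_nonneg ε k r v j) (Finset.mem_univ i)).trans (sum_pay_le hG hv h0)

/-- Rank functions given by a finite table. -/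
def tab {n k N : ℕ} (ρ : Fin n → Fin (k+1) → Fin (N+1)) (i : Fin n) (j : ℕ) : ℕ :=
  ρ i ⟨min j k, Nat.lt_succ_of_le (min_le_right _ _)⟩

lemma exists_rank_opt {n : ℕ} (i0 : Fin n) {ε : ℝ} (hε : 0 < ε) {h : ℝ} {k : ℕ}
    (hk : k = ⌊Real.log h / ε⌋₊)
    (D : Fin n → Measure ℝ) (hD : ∀ i, IsProbabilityMeasure (D i))
    (hs : ∀ i, D i ((Set.Icc (1 : ℝ) h)ᶜ) = 0) :
    ∃ ρ : Fin n → Fin (k+1) → Fin (n*(k+1)+1), (∀ i, Monotone (tab ρ i)) ∧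
      Opt (Measure.pi D) ≤ Real.exp ε * Rev (rankMech ε k (tab ρ)) (Measure.pi D) := by
  classical
  have hiron := fun i => ironing' k (fun j => (D i).real {w | lv ε k w = j}) (gr ε)
    (fun j => measureReal_nonneg) (gr_mono hε) (gr_pos ε 0).le
  choose y hym hy0 hyk hyU hyL using hiron
  let P : ℝ → Finset (Fin n × Fin (k+1)) := fun a =>
    Finset.univ.filter fun q => 0 < y q.1 q.2 ∧ y q.1 q.2 ≤ a
  have hPcard : ∀ a, (P a).card < n*(k+1)+1 := by
    intro a
    refine Nat.lt_succ_of_le ((Finset.card_le_univ _).trans ?_)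
    simp
  let ρ : Fin n → Fin (k+1) → Fin (n*(k+1)+1) := fun i j => ⟨(P (y i j)).card, hPcard _⟩
  have htab : ∀ i j, tab ρ i j = (P (y i j)).card := by
    intro i j
    simp only [tab, ρ]
    rw [← hyk i j]
  have hPm : ∀ a b, a ≤ b → (P a).card ≤ (P b).card := by
    intro a b hab
    apply Finset.card_le_card
    intro q hq
    simp only [P, Finset.mem_filter, Finset.mem_univ, true_and] at hq ⊢
    exact ⟨hq.1, hq.2.trans hab⟩
  have hmem : ∀ i j, 0 < y i j → ((i, ⟨min j k, Nat.lt_succ_of_le (min_le_right _ _)⟩) :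
      Fin n × Fin (k+1)) ∈ P (y i j) := by
    intro i j hj
    simp only [P, Finset.mem_filter, Finset.mem_univ, true_and]
    rw [← hyk i j]
    exact ⟨hj, le_rfl⟩
  have hpos : ∀ i l, 0 < y i l ↔ 0 < tab ρ i l := by
    intro i l
    rw [htab]
    constructor
    · intro hl
      exact Finset.card_pos.2 ⟨_, hmem i l hl⟩
    · intro hl
      obtain ⟨q, hq⟩ := Finset.card_pos.1 hl
      simp only [P, Finset.mem_filter, Finset.mem_univ, true_and] at hq
      linarith [hq.1, hq.2]
  have hord : ∀ i a j b, tab ρ i a ≤ tab ρ j b → y i a ≤ y j b := by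
    intro i a j b hle
    by_contra hc
    push Not at hc
    have hpa : 0 < y i a := (hy0 j b).trans_lt hc
    rw [htab, htab] at hle
    have : (P (y j b)).card < (P (y i a)).card := by
      apply Finset.card_lt_card
      rw [Finset.ssubset_iff_of_subset]
      · refine ⟨_, hmem i a hpa, ?_⟩
        simp only [P, Finset.mem_filter, Finset.mem_univ, true_and, not_and, not_le]
        intro _
        rw [← hyk i a]
        exact hc
      · intro q hq
        simp only [P, Finset.mem_filter, Finset.mem_univ, true_and] at hq ⊢
        exact ⟨hq.1, hq.2.trans hc.le⟩
    omega
  have hmono : ∀ i, Monotone (tab ρ i) := by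
    intro i a b hab
    rw [htab, htab]
    exact hPm _ _ (hym i hab)
  refine ⟨ρ, hmono, ?_⟩
  have hG := rankMech_good hε k (tab ρ) hmono
  have hlvi : ∀ i, Measurable fun v : Fin n → ℝ => lv ε k (v i) := fun i =>
    (lv_meas ε k).comp (measurable_pi_apply i)
  have hallm : ∀ {M : Mech n}, M.Good → ∀ i, Integrable (fun v => M.alloc v i * y i (lv ε k (v i)))
      (Measure.pi D) := by
    intro M hM i
    refine ae_integrable_pi D hD _
      ((hM.2.2.2.1 i).mul ((measurable_of_countable (y i)).comp (hlvi i))) (y i k)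
      (Filter.Eventually.of_forall fun v => ?_)
    have hx := (hM.1 v).1 i
    rw [abs_of_nonneg (mul_nonneg hx.1 (hy0 _ _))]
    exact (mul_le_of_le_one_left (hy0 _ _) hx.2).trans (hym i (lv_le ε k _))
  have hlow : ∀ i, ∫ v, (rankMech ε k (tab ρ)).alloc v i * y i (lv ε k (v i)) ∂(Measure.pi D)
      ≤ ∫ v, (rankMech ε k (tab ρ)).pay v i ∂(Measure.pi D) := by
    intro i
    refine integral_mono_update D hD i _ _ (hallm hG i)
      (rankMech_pay_integrable hε k D hD hs _ hmono i) (Filter.Eventually.of_forall fun v => ?_)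
    have hsupp : ∀ᵐ w ∂(D i), 1 ≤ w ∧ w ≤ h := by
      rw [ae_iff]; exact hs i
    have := oneD_lower (ε := ε) (k := k) (D i) hsupp (tab ρ) hmono v i (y i)
      (fun l => (hpos i l).2) (fun a b hab => by
        by_contra hc
        push Not at hc
        have := hPm _ _ hc
        rw [htab, htab] at hab
        omega) (hyL i)
    simpa using this
  have hrevR : Rev (rankMech ε k (tab ρ)) (Measure.pi D)
      = ∑ i, ∫ v, (rankMech ε k (tab ρ)).pay v i ∂(Measure.pi D) := by
    unfold Rev
    rw [integral_finsetSum _ fun i _ => rankMech_pay_integrable hε k D hD hs _ hmono i]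
  have hR0 : 0 ≤ Rev (rankMech ε k (tab ρ)) (Measure.pi D) :=
    integral_nonneg fun v => Finset.sum_nonneg fun i _ => rankMech_pay_nonneg _ _ _ _ _
  unfold Opt
  refine csSup_le ⟨_, postOne i0, postOne_good i0, rfl⟩ ?_
  rintro _ ⟨M, hM, rfl⟩
  by_cases hi : Integrable (fun v => ∑ i, M.pay v i) (Measure.pi D)
  swap
  · rw [Rev, integral_undef hi]
    exact mul_nonneg (Real.exp_pos ε).le hR0
  have hup := fun i => upper_buyer hε hk D hD hs hM i (y i) (hy0 i) (hym i) (hyU i)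
  choose B hBi hBp hBint using hup
  calc Rev M (Measure.pi D) ≤ ∫ v, ∑ i, B i v ∂(Measure.pi D) := by
        refine integral_mono_ae hi (integrable_finsetSum _ fun i _ => hBi i) ?_
        filter_upwards [ae_all_iff.2 hBp] with v hv
        exact Finset.sum_le_sum fun i _ => hv i
    _ = ∑ i, ∫ v, B i v ∂(Measure.pi D) := integral_finsetSum _ fun i _ => hBi i
    _ ≤ ∑ i, ∫ v, Real.exp ε * (y i (lv ε k (v i)) * M.alloc v i) ∂(Measure.pi D) :=
        Finset.sum_le_sum fun i _ => hBint i
    _ = Real.exp ε * ∫ v, ∑ i, M.alloc v i * y i (lv ε k (v i)) ∂(Measure.pi D) := by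
        rw [integral_finsetSum _ fun i _ => hallm hM i, Finset.mul_sum]
        refine Finset.sum_congr rfl fun i _ => ?_
        rw [integral_const_mul]
        simp only [mul_comm]
    _ ≤ Real.exp ε * ∫ v, ∑ i, (rankMech ε k (tab ρ)).alloc v i * y i (lv ε k (v i))
          ∂(Measure.pi D) := by
        refine mul_le_mul_of_nonneg_left ?_ (Real.exp_pos ε).le
        refine integral_mono_ae (integrable_finsetSum _ fun i _ => hallm hM i)
          (integrable_finsetSum _ fun i _ => hallm hG i) ?_
        filter_upwards [supp_ae hD hs] with v hv
        have := surplus_pointwise (ε := ε) k (tab ρ) y hy0 (fun i l => (hpos i l).1) hord v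
          (fun i => (hv i).1) (M.alloc v) (fun i => ((hM.1 v).1 i).1) (hM.1 v).2
        refine le_trans (le_of_eq ?_) this
        exact Finset.sum_congr rfl fun i _ => mul_comm _ _
    _ = Real.exp ε * ∑ i, ∫ v, (rankMech ε k (tab ρ)).alloc v i * y i (lv ε k (v i))
          ∂(Measure.pi D) := by
        rw [integral_finsetSum _ fun i _ => hallm hG i]
    _ ≤ Real.exp ε * ∑ i, ∫ v, (rankMech ε k (tab ρ)).pay v i ∂(Measure.pi D) :=
        mul_le_mul_of_nonneg_left (Finset.sum_le_sum fun i _ => hlow i) (Real.exp_pos ε).le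
    _ = _ := by rw [hrevR]

/-! ### Concentration -/

lemma exp_moment {Ω : Type*} [MeasurableSpace Ω] (P : Measure Ω) [IsProbabilityMeasure P]
    (Z : Ω → ℝ) (hZ : Measurable Z) {h : ℝ} (hh : 0 < h) (hb : ∀ᵐ ω ∂P, 0 ≤ Z ω ∧ Z ω ≤ h)
    {t : ℝ} (ht : |t| ≤ 1) :
    Integrable (fun ω => Real.exp (t / h * Z ω)) P ∧
    ∫ ω, Real.exp (t / h * Z ω) ∂P ≤ Real.exp ((∫ ω, Z ω ∂P) / h * (t + t ^ 2)) := by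
  have hZi : Integrable Z P := Integrable.of_bound hZ.aestronglyMeasurable h (by
    filter_upwards [hb] with ω hω
    rw [Real.norm_eq_abs, abs_of_nonneg hω.1]; exact hω.2)
  have hpt : ∀ᵐ ω ∂P, Real.exp (t / h * Z ω) ≤ 1 + Z ω / h * (Real.exp t - 1) := by
    filter_upwards [hb] with ω hω
    have h0 : 0 ≤ Z ω / h := div_nonneg hω.1 hh.le
    have h1 : Z ω / h ≤ 1 := (div_le_one hh).2 hω.2
    have := convexOn_exp.2 (Set.mem_univ 0) (Set.mem_univ t) (sub_nonneg.2 h1) h0 (by ring)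
    simp only [smul_eq_mul, mul_zero, zero_add, Real.exp_zero, mul_one] at this
    calc Real.exp (t / h * Z ω) = Real.exp (Z ω / h * t) := by ring_nf
      _ ≤ _ := this
      _ = _ := by ring
  have hi2 : Integrable (fun ω => 1 + Z ω / h * (Real.exp t - 1)) P :=
    (integrable_const 1).add ((hZi.div_const h).mul_const _)
  have hi1 : Integrable (fun ω => Real.exp (t / h * Z ω)) P := by
    refine hi2.mono' (Real.measurable_exp.comp (hZ.const_mul _)).aestronglyMeasurable ?_
    filter_upwards [hpt] with ω hω
    rw [Real.norm_eq_abs, abs_of_pos (Real.exp_pos _)]; exact hω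
  refine ⟨hi1, ?_⟩
  have hμ : 0 ≤ (∫ ω, Z ω ∂P) / h :=
    div_nonneg (integral_nonneg_of_ae (by filter_upwards [hb] with ω hω using hω.1)) hh.le
  have h1 := integral_mono_ae hi1 hi2 hpt
  have h2 : ∫ ω, (1 + Z ω / h * (Real.exp t - 1)) ∂P
      = 1 + (∫ ω, Z ω ∂P) / h * (Real.exp t - 1) := by
    rw [integral_add (integrable_const 1) ((hZi.div_const h).mul_const _), integral_mul_const,
      integral_div]
    simp
  rw [h2] at h1
  have h3 : Real.exp t - 1 ≤ t + t ^ 2 := by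
    have := (abs_le.1 (Real.abs_exp_sub_one_sub_id_le ht)).2
    linarith
  have h4 := mul_le_mul_of_nonneg_left h3 hμ
  have h5 := Real.add_one_le_exp ((∫ ω, Z ω ∂P) / h * (t + t ^ 2))
  linarith

lemma chernoff {Ω : Type*} [MeasurableSpace Ω] (P : Measure Ω) [IsProbabilityMeasure P]
    (Z : Ω → ℝ) (hZ : Measurable Z) {h : ℝ} (hh : 0 < h) (hb : ∀ᵐ ω ∂P, 0 ≤ Z ω ∧ Z ω ≤ h)
    {t : ℝ} (ht : |t| ≤ 1) (m : ℕ) (c : ℝ) :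
    (Measure.pi fun _ : Fin m => P).real {s | c ≤ ∑ a, t / h * Z (s a)}
      ≤ Real.exp (-c + m * ((∫ ω, Z ω ∂P) / h * (t + t ^ 2))) := by
  obtain ⟨h1, h2⟩ := exp_moment P Z hZ hh hb ht
  have he : (fun s : Fin m → Ω => Real.exp (1 * ∑ a, t / h * Z (s a)))
      = fun s => ∏ a, Real.exp (t / h * Z (s a)) := by
    funext s; rw [one_mul, Real.exp_sum]
  have hIntegr : Integrable (fun s : Fin m → Ω => Real.exp (1 * ∑ a, t / h * Z (s a)))
      (Measure.pi fun _ : Fin m => P) := by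
    rw [he]
    exact Integrable.fintype_prod (f := fun _ ω => Real.exp (t / h * Z ω)) fun _ => h1
  have h3 := ProbabilityTheory.measure_ge_le_exp_mul_mgf c zero_le_one hIntegr
  refine h3.trans ?_
  rw [ProbabilityTheory.mgf, he,
    integral_fintype_prod_eq_pow (ι := Fin m) (fun ω => Real.exp (t / h * Z ω)), Fintype.card_fin,
    Real.exp_add]
  have h4 : (∫ ω, Real.exp (t / h * Z ω) ∂P) ^ m
      ≤ Real.exp (m * ((∫ ω, Z ω ∂P) / h * (t + t ^ 2))) := by
    rw [Real.exp_nat_mul]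
    exact pow_le_pow_left₀ (integral_nonneg fun ω => (Real.exp_pos _).le) h2 m
  have h5 : -1 * c = -c := by ring
  rw [h5]
  exact mul_le_mul_of_nonneg_left h4 (Real.exp_pos _).le

lemma two_sided {Ω : Type*} [MeasurableSpace Ω] (P : Measure Ω) [IsProbabilityMeasure P]
    (Z : Ω → ℝ) (hZ : Measurable Z) {h : ℝ} (hh : 0 < h) (hb : ∀ᵐ ω ∂P, 0 ≤ Z ω ∧ Z ω ≤ h)
    {ε : ℝ} (hε : 0 < ε) (hε1 : ε ≤ 1) (m : ℕ) :
    (Measure.pi fun _ : Fin m => P).real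
      {s | m * (ε * ((∫ ω, Z ω ∂P) + 1)) ≤ |∑ a, Z (s a) - m * ∫ ω, Z ω ∂P|}
      ≤ 2 * Real.exp (- (m * ε ^ 2 / h)) := by
  set q := ∫ ω, Z ω ∂P with hq
  have hεh : 0 < ε / h := div_pos hε hh
  have h1 := chernoff P Z hZ hh hb (t := ε) (by rw [abs_of_pos hε]; exact hε1) m
    (ε / h * (m * (q + ε * (q + 1))))
  have h2 := chernoff P Z hZ hh hb (t := -ε) (by rw [abs_neg, abs_of_pos hε]; exact hε1) m
    (-(ε / h) * (m * (q - ε * (q + 1))))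
  rw [← hq] at h1 h2
  have e1 : -(ε / h * (m * (q + ε * (q + 1)))) + m * (q / h * (ε + ε ^ 2)) = - (m * ε ^ 2 / h) := by
    field_simp; ring
  have e2 : -(-(ε / h) * (m * (q - ε * (q + 1)))) + m * (q / h * (-ε + (-ε) ^ 2))
      = - (m * ε ^ 2 / h) := by
    field_simp; ring
  rw [e1] at h1
  rw [e2] at h2
  have hsub : {s : Fin m → Ω | m * (ε * (q + 1)) ≤ |∑ a, Z (s a) - m * q|}
      ⊆ {s | ε / h * (m * (q + ε * (q + 1))) ≤ ∑ a, ε / h * Z (s a)}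
        ∪ {s | -(ε / h) * (m * (q - ε * (q + 1))) ≤ ∑ a, -ε / h * Z (s a)} := by
    intro s hs
    have hs' : m * (ε * (q + 1)) ≤ |∑ a, Z (s a) - m * q| := hs
    rcases le_abs.1 hs' with h3 | h3
    · left
      change ε / h * (m * (q + ε * (q + 1))) ≤ ∑ a, ε / h * Z (s a)
      rw [← Finset.mul_sum]
      exact mul_le_mul_of_nonneg_left (by linarith) hεh.le
    · right
      change -(ε / h) * (m * (q - ε * (q + 1))) ≤ ∑ a, -ε / h * Z (s a)
      rw [← Finset.mul_sum, neg_div, neg_mul, neg_mul, neg_le_neg_iff]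
      exact mul_le_mul_of_nonneg_left (by linarith) hεh.le
  calc _ ≤ _ := measureReal_mono hsub
    _ ≤ _ := measureReal_union_le _ _
    _ ≤ _ := by linarith

/-! ### The learner -/

lemma card_bound {n k : ℕ} (hn : 1 ≤ n) {W : ℝ} (hW : 2 * (n:ℝ) ≤ W) (hk : (n:ℝ) * k ≤ W) :
    2 * ((n*(k+1)+1 : ℕ) : ℝ) ^ (n*(k+1)) ≤ Real.exp (4 * (W * Real.log W)) := by
  have hn' : (1:ℝ) ≤ n := by exact_mod_cast hn
  have hW2 : 2 ≤ W := by linarith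
  have hlog : 0 < Real.log W := Real.log_pos (by linarith)
  have h1 : ((n*(k+1)+1 : ℕ) : ℝ) ≤ W ^ 2 := by push_cast; nlinarith
  have h2 : ((n*(k+1) : ℕ) : ℝ) ≤ 3 / 2 * W := by push_cast; linarith
  have hpos : (0:ℝ) < ((n*(k+1)+1 : ℕ) : ℝ) := by positivity
  have hl1 : Real.log ((n*(k+1)+1 : ℕ) : ℝ) ≤ 2 * Real.log W := by
    have := Real.log_le_log hpos h1
    rw [Real.log_pow] at this
    exact_mod_cast this
  have hl2 : Real.log 2 ≤ Real.log W := Real.log_le_log (by norm_num) hW2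
  have hl0 : 0 ≤ Real.log ((n*(k+1)+1 : ℕ) : ℝ) := Real.log_nonneg (by push_cast; nlinarith)
  rw [← Real.log_le_iff_le_exp (by positivity), Real.log_mul (by norm_num) (by positivity),
    Real.log_pow]
  have h3 : ((n*(k+1) : ℕ) : ℝ) * Real.log ((n*(k+1)+1 : ℕ) : ℝ)
      ≤ 3 / 2 * W * (2 * Real.log W) := mul_le_mul h2 hl1 hl0 (by linarith)
  nlinarith

/-- **Multiplicative sample complexity for `[1,h]`-supported product
distributions.** There is a universal constant `C > 0` such that for all
`n ≥ 1`, `h > 1`, `ε ∈ (0,1)`, `γ ∈ (0,1)`, there is a learning rule `A` from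
samples to measurable DSIC and IR mechanisms such that for every product Borel
distribution `D` on `[1,h]ⁿ`, whenever
`m ≥ C·h·ε⁻²·(n·ε⁻¹·(log h)·log(n·(log h)/ε) + log(1/γ))`, with probability at
least `1-γ` over `m` i.i.d. samples from `D` the learned mechanism has revenue
at least `(1 - C·ε)·Opt(D)`. -/
theorem bounded_support_multiplicative_sample_complexity :
    ∃ C : ℝ, 0 < C ∧
      ∀ (n : ℕ), 1 ≤ n → ∀ h : ℝ, 1 < h →
      ∀ ε γ : ℝ, ε ∈ Set.Ioo (0 : ℝ) 1 → γ ∈ Set.Ioo (0 : ℝ) 1 →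
      ∃ A : (m : ℕ) → (Fin m → (Fin n → ℝ)) → Mech n,
        (∀ m s, (A m s).Good) ∧
        ∀ D : Fin n → Measure ℝ, (∀ i, IsProbabilityMeasure (D i)) →
          (∀ i, D i ((Set.Icc (1 : ℝ) h)ᶜ) = 0) →
          ∀ m : ℕ,
            C * h / ε ^ 2 *
                ((n : ℝ) / ε * Real.log h * Real.log ((n : ℝ) * Real.log h / ε)
                  + Real.log (1 / γ)) ≤ (m : ℝ) →
            ENNReal.ofReal (1 - γ) ≤
              (Measure.pi fun _ : Fin m => Measure.pi D)
                {s | (1 - C * ε) * Opt (Measure.pi D) ≤ Rev (A m s) (Measure.pi D)} := by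
  refine ⟨5, by norm_num, ?_⟩
  intro n hn h hh ε γ hε hγ
  obtain ⟨hε0, hε1⟩ := hε
  obtain ⟨hγ0, hγ1⟩ := hγ
  have hh0 : 0 < h := by linarith
  let i0 : Fin n := ⟨0, hn⟩
  by_cases hcase : Real.log h < 2 * ε
  · -- the price `1` is already good enough
    refine ⟨fun _ _ => postOne i0, fun _ _ => postOne_good i0, ?_⟩
    intro D hD hs m _
    have hall : {s : Fin m → (Fin n → ℝ) | (1 - 5 * ε) * Opt (Measure.pi D)
        ≤ Rev (postOne i0) (Measure.pi D)} = Set.univ := by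
      rw [Set.eq_univ_iff_forall]
      intro _
      change (1 - 5 * ε) * Opt (Measure.pi D) ≤ Rev (postOne i0) (Measure.pi D)
      rw [postOne_rev i0 hD hs]
      have hbdd : ∀ r ∈ {r : ℝ | ∃ M : Mech n, M.Good ∧ r = Rev M (Measure.pi D)}, r ≤ h := by
        rintro _ ⟨M, hM, rfl⟩
        exact rev_le hM hD hh0.le hs
      have hO1 : 1 ≤ Opt (Measure.pi D) := by
        rw [← postOne_rev i0 hD hs]
        exact le_csSup ⟨h, hbdd⟩ ⟨_, postOne_good i0, rfl⟩
      have hOh : Opt (Measure.pi D) ≤ h :=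
        csSup_le ⟨_, postOne i0, postOne_good i0, rfl⟩ hbdd
      have hhe : h ≤ Real.exp (2 * ε) := by
        rw [← Real.log_le_iff_le_exp hh0]; exact hcase.le
      have h1 : 1 - 2 * ε ≤ Real.exp (-(2 * ε)) := by
        have := Real.add_one_le_exp (-(2 * ε)); linarith
      have h2 : Real.exp (-(2 * ε)) * Real.exp (2 * ε) = 1 := by
        rw [← Real.exp_add]; simp
      calc (1 - 5 * ε) * Opt (Measure.pi D) ≤ (1 - 2 * ε) * Opt (Measure.pi D) :=
            mul_le_mul_of_nonneg_right (by linarith) (by linarith)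
        _ ≤ Real.exp (-(2 * ε)) * Opt (Measure.pi D) :=
            mul_le_mul_of_nonneg_right h1 (by linarith)
        _ ≤ Real.exp (-(2 * ε)) * Real.exp (2 * ε) :=
            mul_le_mul_of_nonneg_left (hOh.trans hhe) (Real.exp_pos _).le
        _ = 1 := h2
    rw [hall, measure_univ, ENNReal.ofReal_le_one]
    linarith
  push Not at hcase
  classical
  obtain ⟨k, hk⟩ : ∃ k : ℕ, k = ⌊Real.log h / ε⌋₊ := ⟨_, rfl⟩
  let T := {ρ : Fin n → Fin (k+1) → Fin (n*(k+1)+1) // ∀ i, Monotone (tab ρ i)}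
  haveI : Nonempty T := ⟨⟨fun _ _ => 0, fun i a b _ => le_rfl⟩⟩
  let Z : T → (Fin n → ℝ) → ℝ := fun ρ v => ∑ i, (rankMech ε k (tab ρ.1)).pay v i
  have hZg : ∀ ρ : T, (rankMech ε k (tab ρ.1)).Good := fun ρ => rankMech_good hε0 k _ ρ.2
  have hZm : ∀ ρ : T, Measurable (Z ρ) := fun ρ =>
    Finset.measurable_sum _ fun i _ => (hZg ρ).2.2.2.2 i
  have hERM : ∀ (m : ℕ) (s : Fin m → (Fin n → ℝ)), ∃ ρ : T, ∀ ρ' : T,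
      ∑ a, Z ρ' (s a) ≤ ∑ a, Z ρ (s a) := fun m s =>
    Finite.exists_max (fun ρ : T => ∑ a, Z ρ (s a))
  choose E hE using hERM
  refine ⟨fun m s => rankMech ε k (tab (E m s).1), fun m s => hZg _, ?_⟩
  intro D hD hs m hm
  have hZb : ∀ ρ : T, ∀ᵐ v ∂(Measure.pi D), 0 ≤ Z ρ v ∧ Z ρ v ≤ h := by
    intro ρ
    filter_upwards [supp_ae hD hs] with v hv
    exact ⟨Finset.sum_nonneg fun i _ => rankMech_pay_nonneg _ _ _ _ _,
      sum_pay_le (hZg ρ) hv hh0.le⟩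
  have hRev : ∀ ρ : T, Rev (rankMech ε k (tab ρ.1)) (Measure.pi D) = ∫ v, Z ρ v ∂(Measure.pi D) :=
    fun ρ => rfl
  let Bad : T → Set (Fin m → (Fin n → ℝ)) := fun ρ =>
    {s | m * (ε * ((∫ v, Z ρ v ∂(Measure.pi D)) + 1))
      ≤ |∑ a, Z ρ (s a) - m * ∫ v, Z ρ v ∂(Measure.pi D)|}
  have hBadm : ∀ ρ, MeasurableSet (Bad ρ) := by
    intro ρ
    refine measurableSet_le measurable_const ?_
    refine Measurable.comp (g := fun x : ℝ => |x|) continuous_abs.measurable ?_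
    refine Measurable.sub_const ?_ _
    exact Finset.measurable_sum _ fun a _ => (hZm ρ).comp (measurable_pi_apply a)
  have hBad : ∀ ρ, (Measure.pi fun _ : Fin m => Measure.pi D).real (Bad ρ)
      ≤ 2 * Real.exp (- (m * ε ^ 2 / h)) := fun ρ =>
    two_sided (Measure.pi D) (Z ρ) (hZm ρ) hh0 (hZb ρ) hε0 hε1.le m
  -- sample size
  obtain ⟨W, hW⟩ : ∃ W : ℝ, W = (n:ℝ) * Real.log h / ε := ⟨_, rfl⟩
  have hn' : (1:ℝ) ≤ n := by exact_mod_cast hn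
  have hL2 : 2 ≤ Real.log h / ε := by rw [le_div_iff₀ hε0]; exact hcase
  have hWe : W = n * (Real.log h / ε) := by rw [hW]; ring
  have hW2 : 2 * (n:ℝ) ≤ W := by rw [hWe]; nlinarith
  have hWk : (n:ℝ) * k ≤ W := by
    rw [hWe, hk]
    exact mul_le_mul_of_nonneg_left (Nat.floor_le (by linarith)) (by linarith)
  have hcard : (Fintype.card T : ℝ) ≤ ((n*(k+1)+1 : ℕ) : ℝ) ^ (n*(k+1)) := by
    have h1 : Fintype.card T ≤ (n*(k+1)+1) ^ (n*(k+1)) := by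
      refine (Fintype.card_subtype_le _).trans ?_
      simp only [Fintype.card_pi, Fintype.card_fin, Finset.prod_const, Finset.card_univ]
      rw [← pow_mul, mul_comm]
    exact_mod_cast h1
  have hmε : 5 * (W * Real.log W) + 5 * Real.log (1 / γ) ≤ m * ε ^ 2 / h := by
    have e : (5:ℝ) * h / ε ^ 2 * ((n : ℝ) / ε * Real.log h * Real.log ((n : ℝ) * Real.log h / ε)
        + Real.log (1 / γ)) = (5 * (W * Real.log W) + 5 * Real.log (1 / γ)) * (h / ε ^ 2) := by
      rw [← hW]
      have : (n : ℝ) / ε * Real.log h = W := by rw [hW]; ring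
      rw [this]; ring
    rw [e] at hm
    have h1 := mul_le_mul_of_nonneg_right hm (show 0 ≤ ε ^ 2 / h by positivity)
    have e2 : (5 * (W * Real.log W) + 5 * Real.log (1 / γ)) * (h / ε ^ 2) * (ε ^ 2 / h)
        = 5 * (W * Real.log W) + 5 * Real.log (1 / γ) := by
      field_simp
    rw [e2] at h1
    refine h1.trans (le_of_eq ?_)
    ring
  have hlogW : 0 < Real.log W := Real.log_pos (by linarith)
  have hlogγ : 0 < Real.log (1 / γ) := Real.log_pos (by rw [lt_div_iff₀ hγ0]; linarith)
  have hfail : (Measure.pi fun _ : Fin m => Measure.pi D).real (⋃ ρ, Bad ρ) ≤ γ := by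
    calc _ ≤ ∑ ρ : T, (Measure.pi fun _ : Fin m => Measure.pi D).real (Bad ρ) :=
          measureReal_iUnion_fintype_le _
      _ ≤ ∑ ρ : T, 2 * Real.exp (- (m * ε ^ 2 / h)) := Finset.sum_le_sum fun ρ _ => hBad ρ
      _ = 2 * (Fintype.card T : ℝ) * Real.exp (- (m * ε ^ 2 / h)) := by
          rw [Finset.sum_const, Finset.card_univ, nsmul_eq_mul]; ring
      _ ≤ Real.exp (4 * (W * Real.log W)) * Real.exp (- (m * ε ^ 2 / h)) := by
          refine mul_le_mul_of_nonneg_right ?_ (Real.exp_pos _).le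
          exact (mul_le_mul_of_nonneg_left hcard (by norm_num)).trans (card_bound hn hW2 hWk)
      _ = Real.exp (4 * (W * Real.log W) + - (m * ε ^ 2 / h)) := by rw [Real.exp_add]
      _ ≤ Real.exp (- Real.log (1 / γ)) := by
          refine Real.exp_le_exp.2 ?_
          have : 0 ≤ W * Real.log W := mul_nonneg (by linarith) hlogW.le
          linarith
      _ = γ := by rw [one_div, Real.log_inv, neg_neg, Real.exp_log hγ0]
  -- conclusion
  obtain ⟨ρ₀, hρm, hρ⟩ := exists_rank_opt i0 hε0 hk D hD hs
  have hm0 : (0:ℝ) < m := by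
    have h1 : 0 < m * ε ^ 2 / h := by
      have : 0 ≤ W * Real.log W := mul_nonneg (by linarith) hlogW.le
      linarith
    by_contra hc
    have h2 : (m:ℝ) = 0 := le_antisymm (not_lt.1 hc) (Nat.cast_nonneg m)
    rw [h2] at h1; simp at h1
  have hO1 : 1 ≤ Opt (Measure.pi D) := by
    rw [← postOne_rev i0 hD hs]
    refine le_csSup ⟨h, ?_⟩ ⟨_, postOne_good i0, rfl⟩
    rintro _ ⟨M, hM, rfl⟩
    exact rev_le hM hD hh0.le hs
  have hsub : (⋃ ρ, Bad ρ)ᶜ ⊆ {s | (1 - 5 * ε) * Opt (Measure.pi D)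
      ≤ Rev (rankMech ε k (tab (E m s).1)) (Measure.pi D)} := by
    intro s hsB
    have hg : ∀ ρ, |∑ a, Z ρ (s a) - m * ∫ v, Z ρ v ∂(Measure.pi D)|
        < m * (ε * ((∫ v, Z ρ v ∂(Measure.pi D)) + 1)) := by
      intro ρ
      by_contra hc
      exact hsB (Set.mem_iUnion.2 ⟨ρ, not_lt.1 hc⟩)
    change (1 - 5 * ε) * Opt (Measure.pi D) ≤ Rev (rankMech ε k (tab (E m s).1)) (Measure.pi D)
    rw [hRev]
    have h1 := (abs_lt.1 (hg (E m s))).2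
    have h2 := (abs_lt.1 (hg ⟨ρ₀, hρm⟩)).1
    have h3 := hE m s ⟨ρ₀, hρm⟩
    have h4 : Opt (Measure.pi D) ≤ Real.exp ε * ∫ v, Z ⟨ρ₀, hρm⟩ v ∂(Measure.pi D) := hρ
    set O := Opt (Measure.pi D)
    set q := ∫ v, Z (E m s) v ∂(Measure.pi D)
    set q0 := ∫ v, Z ⟨ρ₀, hρm⟩ v ∂(Measure.pi D)
    have h5 : (m:ℝ) * (q0 - ε * (q0 + 1)) < m * (q + ε * (q + 1)) := by linarith
    have h6 : q0 - ε * (q0 + 1) < q + ε * (q + 1) := lt_of_mul_lt_mul_left h5 hm0.le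
    have h7 : (1 - ε) * O ≤ q0 := by
      have h8 : 1 - ε ≤ Real.exp (-ε) := by
        have := Real.add_one_le_exp (-ε); linarith
      have h9 : Real.exp (-ε) * Real.exp ε = 1 := by rw [← Real.exp_add]; simp
      calc (1 - ε) * O ≤ Real.exp (-ε) * O := mul_le_mul_of_nonneg_right h8 (by linarith)
        _ ≤ Real.exp (-ε) * (Real.exp ε * q0) := mul_le_mul_of_nonneg_left h4 (Real.exp_pos _).le
        _ = q0 := by rw [← mul_assoc, h9, one_mul]
    have h10 : (1 - ε) * ((1 - ε) * O) ≤ (1 - ε) * q0 :=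
      mul_le_mul_of_nonneg_left h7 (by linarith)
    have h11 : (1 - 5 * ε) * O * (1 + ε) ≤ q * (1 + ε) := by
      have h12 : ε * 1 ≤ ε * O := mul_le_mul_of_nonneg_left hO1 hε0.le
      have h13 : 0 ≤ ε ^ 2 * O := by positivity
      nlinarith
    exact le_of_mul_le_mul_right h11 (by linarith)
  refine le_trans ?_ (measure_mono hsub)
  rw [prob_compl_eq_one_sub (MeasurableSet.iUnion hBadm), ← ENNReal.ofReal_one,
    ← ofReal_measureReal, ← ENNReal.ofReal_sub _ measureReal_nonneg]
  exact ENNReal.ofReal_le_ofReal (by linarith)
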